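/- arXiv:1003.1548 — 9 statements merged into one kernel-verified Lean document; each statement's English description precedes it below -/
import Mathlib

section
/- Let β ∈ ℝ and let c, n : ℝ → ℝ be twice continuously differentiable. Set v(x) = exp(β c(x)) and, for Δ > 0, define the jump probabilities p_l(y,Δ) = v(y−Δ)/(v(y−Δ)+v(y+Δ)) and p_r(y,Δ) = v(y+Δ)/(v(y−Δ)+v(y+Δ)). Then for every x ∈ ℝ, lim_{Δ→0+} [p_r(x−Δ,Δ) n(x−Δ) + p_l(x+Δ,Δ) n(x+Δ) − n(x)] / Δ² = (1/2) n''(x) − β (c'(x) n(x))', i.e. the discrete chemotactic jump step has the continuum limit (1/2) n'' − β (c' n)'. -/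
open Real Filter Set

lemma symm_second_deriv (G G' : ℝ → ℝ) (L : ℝ) (h1 : ∀ t, HasDerivAt G (G' t) t)
    (h2 : HasDerivAt G' L 0) :
    Tendsto (fun Δ : ℝ => (G Δ + G (-Δ) - 2 * G 0) / Δ ^ 2)
      (nhdsWithin 0 (Set.Ioi 0)) (nhds L) := by
  have hG : Continuous G := continuous_iff_continuousAt.2 fun t => (h1 t).continuousAt
  refine HasDerivAt.lhopital_zero_nhdsGT (f' := fun t => G' t - G' (-t)) (g' := fun t => 2 * t)
    ?_ ?_ ?_ ?_ ?_ ?_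
  · refine Eventually.of_forall fun t => ?_
    have h3 : HasDerivAt (fun t => G (-t)) (G' (-t) * (-1)) t :=
      (h1 (-t)).comp t (hasDerivAt_neg t)
    refine (((h1 t).add h3).sub_const (2 * G 0)).congr_deriv ?_
    ring
  · refine Eventually.of_forall fun t => ?_
    simpa using hasDerivAt_pow 2 t
  · filter_upwards [self_mem_nhdsWithin] with t ht
    have : (0:ℝ) < t := ht
    positivity
  · have : Continuous (fun Δ : ℝ => G Δ + G (-Δ) - 2 * G 0) := by fun_prop
    refine (this.tendsto' 0 0 ?_).mono_left nhdsWithin_le_nhds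
    simp; ring
  · have : Continuous (fun Δ : ℝ => Δ ^ 2) := by fun_prop
    exact (this.tendsto' 0 0 (by simp)).mono_left nhdsWithin_le_nhds
  · have h3 : HasDerivAt (fun t => G' (-t)) (L * (-1)) 0 := by
      have h2' : HasDerivAt G' L (-0) := by simpa using h2
      exact h2'.comp 0 (hasDerivAt_neg 0)
    have h4 : HasDerivAt (fun t => (G' t - G' (-t)) / 2) L 0 := by
      refine ((h2.sub h3).div_const 2).congr_deriv ?_
      ring
    have h5 := (hasDerivAt_iff_tendsto_slope.1 h4).mono_left
      (nhdsWithin_mono 0 (fun t (ht : 0 < t) => ht.ne') :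
        nhdsWithin (0:ℝ) (Set.Ioi 0) ≤ nhdsWithin 0 {0}ᶜ)
    refine h5.congr' ?_
    filter_upwards [self_mem_nhdsWithin] with t ht
    have : t ≠ 0 := (show (0:ℝ) < t from ht).ne'
    simp [slope_def_field]
    field_simp

/-- continuum limit of the discrete chemotactic jump step:
`lim_{Δ→0+} [p_r(x−Δ,Δ) n(x−Δ) + p_l(x+Δ,Δ) n(x+Δ) − n(x)]/Δ² = (1/2) n''(x) − β (c' n)'(x)`. -/
theorem chemotaxis_jump_continuum_limit
    (β : ℝ) (c n : ℝ → ℝ) (hc : ContDiff ℝ 2 c) (hn : ContDiff ℝ 2 n)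
    (v : ℝ → ℝ) (hv : ∀ x, v x = Real.exp (β * c x))
    (pl pr : ℝ → ℝ → ℝ)
    (hpl : ∀ y Δ, pl y Δ = v (y - Δ) / (v (y - Δ) + v (y + Δ)))
    (hpr : ∀ y Δ, pr y Δ = v (y + Δ) / (v (y - Δ) + v (y + Δ)))
    (x : ℝ) :
    Tendsto
      (fun Δ : ℝ =>
        (pr (x - Δ) Δ * n (x - Δ) + pl (x + Δ) Δ * n (x + Δ) - n x) / Δ ^ 2)
      (nhdsWithin 0 (Set.Ioi 0))
      (nhds ((1 / 2) * deriv (deriv n) x - β * deriv (fun y => deriv c y * n y) x)) := by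
  have key : ∀ f : ℝ → ℝ, ContDiff ℝ 2 f →
      (∀ y, HasDerivAt f (deriv f y) y) ∧ (∀ y, HasDerivAt (deriv f) (deriv (deriv f) y) y) := by
    intro f hf
    have h1 : ContDiff ℝ 1 (deriv f) := by
      have : ContDiff ℝ (1 + 1) f := by norm_num; exact hf
      exact (contDiff_succ_iff_deriv.1 this).2.2
    exact ⟨fun y => (hf.differentiable (by norm_num) y).hasDerivAt,
      fun y => (h1.differentiable (by norm_num) y).hasDerivAt⟩
  obtain ⟨c1, c2⟩ := key c hc
  obtain ⟨n1, n2⟩ := key n hn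
  have hvpos : ∀ y, 0 < v y := fun y => by rw [hv]; positivity
  have hv1 : ∀ y, HasDerivAt v (v y * (β * deriv c y)) y := by
    intro y
    have : v = fun x => Real.exp (β * c x) := funext hv
    rw [this]
    exact ((c1 y).const_mul β).exp
  have a1 : ∀ t : ℝ, HasDerivAt (fun t => x + t) 1 t := fun t => (hasDerivAt_id t).const_add x
  have a2 : ∀ t : ℝ, HasDerivAt (fun t => x + 2 * t) 2 t := fun t => by
    simpa using ((hasDerivAt_id t).const_mul 2).const_add x
  have N1 : ∀ t, HasDerivAt (fun t => n (x + t)) (deriv n (x + t) * 1) t :=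
    fun t => (n1 _).comp t (a1 t)
  have N2 : ∀ t, HasDerivAt (fun t => deriv n (x + t)) (deriv (deriv n) (x + t) * 1) t :=
    fun t => (n2 _).comp t (a1 t)
  have C2 : ∀ t, HasDerivAt (fun t => deriv c (x + 2 * t)) (deriv (deriv c) (x + 2 * t) * 2) t :=
    fun t => (c2 _).comp t (a2 t)
  have V1 : ∀ t, HasDerivAt (fun t => v (x + 2 * t))
      (v (x + 2 * t) * (β * deriv c (x + 2 * t)) * 2) t :=
    fun t => (hv1 _).comp t (a2 t)
  have D1 : ∀ t, HasDerivAt (fun t => v x + v (x + 2 * t)) _ t := fun t => (V1 t).const_add (v x)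
  have hD : ∀ t, v x + v (x + 2 * t) ≠ 0 := fun t => (add_pos (hvpos _) (hvpos _)).ne'
  have G1 := fun t => ((N1 t).mul_const (v x)).div (D1 t) (hD t)
  have hx := (hvpos x).ne'
  have hd : deriv (fun y => deriv c y * n y) x
      = deriv (deriv c) x * n x + deriv c x * deriv n x := ((c2 x).mul (n1 x)).deriv
  have G2 := ((((N2 0).mul_const 1).mul_const (v x) |>.mul (D1 0)).sub
      (((N1 0).mul_const (v x)).mul ((((V1 0).mul ((C2 0).const_mul β)).mul_const 2)))).div
      ((D1 0).pow 2) (pow_ne_zero 2 (hD 0))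
  have main := symm_second_deriv (fun t => n (x + t) * v x / (v x + v (x + 2 * t)))
    (fun t => (deriv n (x + t) * 1 * v x * (v x + v (x + 2 * t)) -
      n (x + t) * v x * (v (x + 2 * t) * (β * deriv c (x + 2 * t)) * 2)) /
        (v x + v (x + 2 * t)) ^ 2)
    ((1 / 2) * deriv (deriv n) x - β * deriv (fun y => deriv c y * n y) x)
    (fun t => G1 t) (by
      rw [hd]
      refine HasDerivAt.congr_deriv (f := fun t => (deriv n (x + t) * 1 * v x * (v x + v (x + 2 * t)) - n (x + t) * v x * (v (x + 2 * t) * (β * deriv c (x + 2 * t)) * 2)) / (v x + v (x + 2 * t)) ^ 2) G2 ?_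
      simp
      field_simp
      ring)
  refine main.congr fun Δ => ?_
  rw [hpr, hpl]
  have e1 : x - Δ + Δ = x := by ring
  have e2 : x - Δ - Δ = x + 2 * (-Δ) := by ring
  have e3 : x + Δ - Δ = x := by ring
  have e4 : x + Δ + Δ = x + 2 * Δ := by ring
  rw [e1, e2, e3, e4]
  have := hD Δ
  have := hD (-Δ)
  congr 1
  simp only [mul_zero, add_zero, ← sub_eq_add_neg]
  rw [add_comm (v (x + 2 * -Δ))]
  field_simp
  ring
end

section
/- Let 0 < γ < 1, τ > 0 and let ψ(t) = (γ/τ)(1 + t/τ)^{−(1+γ)} be the Pareto waiting-time density. Then lim_{s→0+} (1 − L{ψ}(s)) / (sτ)^γ = Γ(1−γ), i.e. the Laplace transform of ψ satisfies L{ψ}(s) = 1 − Γ(1−γ)(sτ)^γ + o(s^γ) as s → 0+. -/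
open Real Set Filter MeasureTheory

lemma aux_int (s τ a : ℝ) (hs : 0 < s) (hτ : 0 < τ) (ha : 0 ≤ a) :
    IntegrableOn (fun t : ℝ => Real.exp (-s * t) * (1 + t / τ) ^ (-a)) (Ioi 0) := by
  refine Integrable.mono' (integrableOn_exp_mul_Ioi (a := -s) (by linarith) 0) ?_ ?_
  · exact Measurable.aestronglyMeasurable (by fun_prop)
  · refine (ae_restrict_mem measurableSet_Ioi).mono fun t ht => ?_
    have ht : 0 < t := ht
    have h1 : 1 ≤ 1 + t / τ := by have : 0 < t / τ := by positivity
                                  linarith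
    have h2 : (1 + t / τ) ^ (-a) ≤ 1 := Real.rpow_le_one_of_one_le_of_nonpos h1 (by linarith)
    rw [Real.norm_of_nonneg (by positivity)]
    exact mul_le_of_le_one_right (by positivity) h2

lemma aux_eq (γ τ s : ℝ) (hγ0 : 0 < γ) (hτ : 0 < τ) (hs : 0 < s) :
    1 - ∫ t in Ioi (0 : ℝ), Real.exp (-s * t) * ((γ / τ) * (1 + t / τ) ^ (-(1 + γ)))
      = s * ∫ t in Ioi (0 : ℝ), Real.exp (-s * t) * (1 + t / τ) ^ (-γ) := by
  have i1 := aux_int s τ γ hs hτ hγ0.le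
  have i2 := aux_int s τ (1 + γ) hs hτ (by linarith)
  have j1 := i1.const_mul s
  have j2 : IntegrableOn (fun t : ℝ =>
      Real.exp (-s * t) * ((γ / τ) * (1 + t / τ) ^ (-(1 + γ)))) (Ioi 0) :=
    (i2.const_mul (γ / τ)).congr (Eventually.of_forall fun t => by ring)
  have hd : ∀ t ∈ Ici (0 : ℝ), HasDerivAt
      (fun t : ℝ => -(Real.exp (-s * t) * (1 + t / τ) ^ (-γ)))
      (s * (Real.exp (-s * t) * (1 + t / τ) ^ (-γ)) +
        Real.exp (-s * t) * ((γ / τ) * (1 + t / τ) ^ (-(1 + γ)))) t := by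
    intro t ht
    have ht : 0 ≤ t := ht
    have hp : 0 < 1 + t / τ := by positivity
    have e1 : HasDerivAt (fun t : ℝ => Real.exp (-s * t)) (Real.exp (-s * t) * (-s * 1)) t :=
      ((hasDerivAt_id t).const_mul (-s)).exp
    have e2 : HasDerivAt (fun t : ℝ => 1 + t / τ) (1 / τ) t :=
      ((hasDerivAt_id t).div_const τ).const_add 1
    have e3 := e2.rpow_const (p := -γ) (Or.inl hp.ne')
    refine (e1.mul e3).neg.congr_deriv ?_
    rw [show -γ - 1 = -(1 + γ) by ring]
    ring
  have hlim : Tendsto (fun t : ℝ => -(Real.exp (-s * t) * (1 + t / τ) ^ (-γ))) atTop (nhds 0) := by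
    have h1 : Tendsto (fun t : ℝ => Real.exp (-s * t)) atTop (nhds 0) :=
      Real.tendsto_exp_atBot.comp (tendsto_id.const_mul_atTop_of_neg (by linarith))
    have h2 : Tendsto (fun t : ℝ => (1 + t / τ) ^ (-γ)) atTop (nhds 0) :=
      (tendsto_rpow_neg_atTop hγ0).comp
        (tendsto_atTop_add_const_left _ _ (tendsto_id.atTop_div_const hτ))
    simpa using (h1.mul h2).neg
  have key := integral_Ioi_of_hasDerivAt_of_tendsto' hd (j1.add j2) hlim
  rw [integral_add j1 j2, integral_const_mul] at key
  simp at key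
  simp
  linarith

lemma aux_eq2 (γ τ s : ℝ) (hτ : 0 < τ) (hs : 0 < s) :
    (s * ∫ t in Ioi (0 : ℝ), Real.exp (-s * t) * (1 + t / τ) ^ (-γ)) / (s * τ) ^ γ
      = ∫ u in Ioi (0 : ℝ), Real.exp (-u) * (s * τ + u) ^ (-γ) := by
  have h := integral_comp_mul_left_Ioi' (fun u : ℝ => Real.exp (-u) * (s * τ + u) ^ (-γ)) 0 hs
  rw [mul_zero] at h
  rw [← h, smul_eq_mul, mul_div_assoc]
  congr 1
  rw [← integral_div]
  refine setIntegral_congr_fun measurableSet_Ioi fun t ht => ?_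
  have ht : 0 < t := ht
  have : s * τ + s * t = (s * τ) * (1 + t / τ) := by field_simp
  rw [this, Real.mul_rpow (x := s * τ) (y := 1 + t / τ) (by positivity) (by positivity), Real.rpow_neg (x := s * τ) (by positivity)]
  rw [neg_mul]
  ring

/-- for the Pareto waiting-time density,
`lim_{s→0+} (1 − L{ψ}(s)) / (sτ)^γ = Γ(1−γ)`. -/
theorem pareto_laplace_small_s_asymptotics
    (γ τ : ℝ) (hγ0 : 0 < γ) (hγ1 : γ < 1) (hτ : 0 < τ)
    (ψ : ℝ → ℝ) (hψ : ∀ t, ψ t = (γ / τ) * (1 + t / τ) ^ (-(1 + γ)) ) :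
    Tendsto
      (fun s : ℝ =>
        (1 - ∫ t in Set.Ioi (0 : ℝ), Real.exp (-s * t) * ψ t) / (s * τ) ^ γ)
      (nhdsWithin 0 (Set.Ioi 0))
      (nhds (Real.Gamma (1 - γ))) := by
  have hI := Real.GammaIntegral_convergent (s := 1 - γ) (by linarith)
  rw [Real.Gamma_eq_integral (by linarith)]
  rw [show 1 - γ - 1 = -γ by ring] at *
  simp only [hψ]
  have hT : Tendsto (fun s : ℝ => ∫ u in Ioi (0 : ℝ), Real.exp (-u) * (s * τ + u) ^ (-γ))
      (nhdsWithin 0 (Set.Ioi 0)) (nhds (∫ u in Ioi (0 : ℝ), Real.exp (-u) * u ^ (-γ))) := by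
    refine tendsto_integral_filter_of_dominated_convergence _ ?_ ?_ hI ?_
    · exact Eventually.of_forall fun s => Measurable.aestronglyMeasurable (by fun_prop)
    · filter_upwards [self_mem_nhdsWithin] with s hs
      have hs : 0 < s := hs
      refine (ae_restrict_mem measurableSet_Ioi).mono fun u hu => ?_
      have hu : 0 < u := hu
      rw [Real.norm_of_nonneg (by positivity)]
      refine mul_le_mul_of_nonneg_left ?_ (by positivity)
      have : 0 < s * τ := by positivity
      exact Real.rpow_le_rpow_of_nonpos hu (by linarith) (by linarith)
    · refine (ae_restrict_mem measurableSet_Ioi).mono fun u hu => ?_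
      have hu : 0 < u := hu
      refine Tendsto.mono_left ?_ nhdsWithin_le_nhds
      have hc : ContinuousAt (fun s : ℝ => Real.exp (-u) * (s * τ + u) ^ (-γ)) 0 := by
        refine continuousAt_const.mul (ContinuousAt.rpow_const (by fun_prop) (Or.inl ?_))
        simpa using hu.ne'
      simpa [ContinuousAt] using hc
  refine hT.congr' ?_
  filter_upwards [self_mem_nhdsWithin] with s hs
  rw [aux_eq γ τ s hγ0 hτ hs, aux_eq2 γ τ s hτ hs]
end

section
/- Let 0 < γ < 1, τ > 0, let ψ(t) = (γ/τ)(1 + t/τ)^{−(1+γ)} be the Pareto waiting-time density and Φ(t) = (1 + t/τ)^{−γ} its survival probability. Then lim_{s→0+} τ^γ s^{γ−1} · L{ψ}(s) / L{Φ}(s) = 1/Γ(1−γ); that is, the ratio of Laplace transforms satisfies L{ψ}(s)/L{Φ}(s) ~ A_γ s^{1−γ}/τ^γ as s → 0+ with A_γ = 1/Γ(1−γ). -/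
open Real Set Filter MeasureTheory

lemma aux_psi (γ τ : ℝ) (hγ0 : 0 < γ) (hτ : 0 < τ) :
    Tendsto (fun s : ℝ => ∫ t in Set.Ioi (0 : ℝ),
      Real.exp (-s * t) * ((γ / τ) * (1 + t / τ) ^ (-(1 + γ))))
      (nhdsWithin 0 (Set.Ioi 0)) (nhds 1) := by
  have hd : ∀ t ∈ Set.Ici (0:ℝ), HasDerivAt (fun t : ℝ => -(1 + t / τ) ^ (-γ))
      ((γ / τ) * (1 + t / τ) ^ (-(1 + γ))) t := by
    intro t ht
    have ht : 0 ≤ t := ht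
    have hp : 0 < 1 + t / τ := by positivity
    have h1 : HasDerivAt (fun t : ℝ => 1 + t / τ) (1 / τ) t :=
      ((hasDerivAt_id t).div_const τ).const_add 1
    have h2 := (h1.rpow_const (p := -γ) (Or.inl hp.ne')).neg
    have e : (γ / τ) * (1 + t / τ) ^ (-(1 + γ)) =
        -(1 / τ * -γ * (1 + t / τ) ^ (-γ - 1)) := by
      rw [show -γ - 1 = -(1 + γ) by ring]
      ring
    rw [e]
    exact h2
  have hnn : ∀ t ∈ Set.Ioi (0:ℝ), 0 ≤ (γ / τ) * (1 + t / τ) ^ (-(1 + γ)) := by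
    intro t ht
    have ht : 0 < t := ht
    positivity
  have hlim : Tendsto (fun t : ℝ => -(1 + t / τ) ^ (-γ)) atTop (nhds 0) := by
    have h1 : Tendsto (fun t : ℝ => 1 + t / τ) atTop atTop :=
      tendsto_atTop_add_const_left _ _ (tendsto_id.atTop_div_const hτ)
    simpa using ((tendsto_rpow_neg_atTop hγ0).comp h1).neg
  have hint := integrableOn_Ioi_deriv_of_nonneg' hd hnn hlim
  have hval := integral_Ioi_of_hasDerivAt_of_nonneg' hd hnn hlim
  have hval' : ∫ t in Set.Ioi (0:ℝ), (γ / τ) * (1 + t / τ) ^ (-(1 + γ)) = 1 := by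
    rw [hval]; simp
  have hN := congrArg nhds hval'
  refine Tendsto.mono_right ?_ hN.le
  apply tendsto_integral_filter_of_dominated_convergence
    (fun t => (γ / τ) * (1 + t / τ) ^ (-(1 + γ)))
  · refine Eventually.of_forall fun s => ?_
    exact (by fun_prop : Measurable fun t : ℝ => Real.exp (-s * t)).aestronglyMeasurable.mul hint.1
  · filter_upwards [self_mem_nhdsWithin] with s hs
    have hs : 0 < s := hs
    filter_upwards [ae_restrict_mem measurableSet_Ioi] with t ht
    have h0 := hnn t ht
    have ht : 0 < t := ht
    rw [norm_mul, Real.norm_of_nonneg h0, Real.norm_of_nonneg (Real.exp_pos _).le]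
    refine mul_le_of_le_one_left h0 (Real.exp_le_one_iff.2 ?_)
    nlinarith [mul_pos hs ht]
  · exact hint
  · refine Eventually.of_forall fun t => ?_
    have hc : Continuous fun s : ℝ =>
      Real.exp (-s * t) * ((γ / τ) * (1 + t / τ) ^ (-(1 + γ))) := by fun_prop
    have := (hc.tendsto 0).mono_left (nhdsWithin_le_nhds (s := Set.Ioi 0))
    simpa using this

lemma aux_J (γ τ : ℝ) (hγ0 : 0 < γ) (hγ1 : γ < 1) (hτ : 0 < τ) :
    Tendsto (fun s : ℝ => ∫ u in Set.Ioi (0 : ℝ),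
      Real.exp (-u) * (s * τ + u) ^ (-γ))
      (nhdsWithin 0 (Set.Ioi 0)) (nhds (Real.Gamma (1 - γ))) := by
  have hint := Real.GammaIntegral_convergent (s := 1 - γ) (by linarith)
  rw [Real.Gamma_eq_integral (by linarith)]
  rw [show 1 - γ - 1 = -γ by ring] at *
  apply tendsto_integral_filter_of_dominated_convergence
    (fun u => Real.exp (-u) * u ^ (-γ))
  · refine Eventually.of_forall fun s => ?_
    exact (by fun_prop : Measurable fun u : ℝ =>
      Real.exp (-u) * (s * τ + u) ^ (-γ)).aestronglyMeasurable
  · filter_upwards [self_mem_nhdsWithin] with s hs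
    have hs : 0 < s := hs
    filter_upwards [ae_restrict_mem measurableSet_Ioi] with t ht
    have ht : 0 < t := ht
    rw [Real.norm_of_nonneg (by positivity)]
    refine mul_le_mul_of_nonneg_left ?_ (Real.exp_pos _).le
    exact Real.rpow_le_rpow_of_nonpos ht (by nlinarith [mul_pos hs hτ]) (by linarith)
  · exact hint
  · filter_upwards [ae_restrict_mem measurableSet_Ioi] with t ht
    have ht : 0 < t := ht
    have hc : ContinuousAt (fun s : ℝ => Real.exp (-t) * (s * τ + t) ^ (-γ)) 0 := by
      refine continuousAt_const.mul (ContinuousAt.rpow_const (by fun_prop) (Or.inl ?_))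
      simpa using ht.ne'
    have := hc.tendsto.mono_left (nhdsWithin_le_nhds (s := Set.Ioi 0))
    simpa using this

lemma aux_phi (γ τ s : ℝ) (hτ : 0 < τ) (hs : 0 < s) :
    ∫ t in Set.Ioi (0 : ℝ), Real.exp (-s * t) * (1 + t / τ) ^ (-γ) =
    τ ^ γ * s ^ (γ - 1) * ∫ u in Set.Ioi (0 : ℝ), Real.exp (-u) * (s * τ + u) ^ (-γ) := by
  have h := integral_comp_mul_left_Ioi
    (fun u : ℝ => Real.exp (-u) * (s * τ + u) ^ (-γ)) 0 hs
  rw [mul_zero, smul_eq_mul] at h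
  have h2 : ∫ u in Set.Ioi (0 : ℝ), Real.exp (-u) * (s * τ + u) ^ (-γ) =
      s * ∫ x in Set.Ioi (0 : ℝ), Real.exp (-(s * x)) * (s * τ + s * x) ^ (-γ) := by
    rw [h]; field_simp
  rw [h2, ← mul_assoc, ← integral_const_mul]
  refine setIntegral_congr_fun measurableSet_Ioi fun t ht => ?_
  have ht : 0 < t := ht
  have e : s * τ + s * t = s * (τ * (1 + t / τ)) := by field_simp
  rw [e, Real.mul_rpow hs.le (by positivity), Real.mul_rpow hτ.le (by positivity),
    Real.rpow_sub_one hs.ne', Real.rpow_neg hs.le, Real.rpow_neg hτ.le, neg_mul]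
  have := (Real.rpow_pos_of_pos hs γ).ne'
  have := (Real.rpow_pos_of_pos hτ γ).ne'
  field_simp

/-- for the Pareto waiting-time density ψ with survival probability Φ,
`lim_{s→0+} τ^γ s^{γ−1} · L{ψ}(s)/L{Φ}(s) = 1/Γ(1−γ)`. -/
theorem pareto_laplace_ratio_small_s
    (γ τ : ℝ) (hγ0 : 0 < γ) (hγ1 : γ < 1) (hτ : 0 < τ)
    (ψ Φ : ℝ → ℝ)
    (hψ : ∀ t, ψ t = (γ / τ) * (1 + t / τ) ^ (-(1 + γ)) )
    (hΦ : ∀ t, Φ t = (1 + t / τ) ^ (-γ)) :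
    Tendsto
      (fun s : ℝ =>
        τ ^ γ * s ^ (γ - 1) *
          ((∫ t in Set.Ioi (0 : ℝ), Real.exp (-s * t) * ψ t) /
            (∫ t in Set.Ioi (0 : ℝ), Real.exp (-s * t) * Φ t)))
      (nhdsWithin 0 (Set.Ioi 0))
      (nhds (1 / Real.Gamma (1 - γ))) := by
  have hG : Real.Gamma (1 - γ) ≠ 0 := (Real.Gamma_pos_of_pos (by linarith)).ne'
  refine ((aux_psi γ τ hγ0 hτ).div (aux_J γ τ hγ0 hγ1 hτ) hG).congr' ?_
  filter_upwards [self_mem_nhdsWithin] with s hs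
  have hs : 0 < s := hs
  simp only [hψ, hΦ, Pi.div_apply]
  rw [aux_phi γ τ s hτ hs]
  have h : τ ^ γ * s ^ (γ - 1) ≠ 0 := by positivity
  rw [← mul_div_assoc, mul_div_mul_left _ _ h]
end

section
/- (Abelian theorem for heavy-tailed waiting times.) Let ψ be a waiting-time density, let 0 < γ < 1 and κ, τ > 0, and suppose ψ has the heavy tail ψ(t) ~ (κ/τ)(t/τ)^{−1−γ} as t → ∞, i.e. lim_{t→∞} t^{1+γ} ψ(t) = κ τ^γ. Then lim_{s→0+} (1 − L{ψ}(s)) / s^γ = (κ Γ(1−γ)/γ) τ^γ. -/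
open Real Set Filter MeasureTheory

lemma aux_integrable (γ : ℝ) (hγ0 : 0 < γ) (hγ1 : γ < 1) :
    IntegrableOn (fun u : ℝ => (1 - Real.exp (-u)) * u ^ (-1 - γ)) (Ioi 0) := by
  have hm : Measurable (fun u : ℝ => (1 - Real.exp (-u)) * u ^ (-1 - γ)) := by fun_prop
  rw [← Ioc_union_Ioi_eq_Ioi (zero_le_one : (0:ℝ) ≤ 1)]
  refine IntegrableOn.union ?_ ?_
  · have h1 : IntegrableOn (fun x : ℝ => x ^ (-γ)) (Ioc 0 1) := by
      have := intervalIntegral.intervalIntegrable_rpow' (a := 0) (b := 1) (r := -γ) (by linarith)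
      rwa [intervalIntegrable_iff_integrableOn_Ioc_of_le zero_le_one] at this
    refine Integrable.mono' h1 hm.aestronglyMeasurable ?_
    refine (ae_restrict_iff' measurableSet_Ioc).2 (Eventually.of_forall fun x hx => ?_)
    have hx0 : 0 < x := hx.1
    have e1 : Real.exp (-x) ≤ 1 := Real.exp_le_one_iff.2 (by linarith)
    have e2 := Real.one_sub_le_exp_neg x
    have hp : 0 ≤ x ^ (-1 - γ) := Real.rpow_nonneg hx0.le _
    rw [Real.norm_of_nonneg (mul_nonneg (by linarith) hp)]
    have : x ^ (-γ) = x * x ^ (-1 - γ) := by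
      nth_rewrite 2 [← Real.rpow_one x]
      rw [← Real.rpow_add hx0]; congr 1; ring
    rw [this]
    exact mul_le_mul_of_nonneg_right (by linarith) hp
  · have h1 := integrableOn_Ioi_rpow_of_lt (a := -1 - γ) (c := 1) (by linarith) one_pos
    refine Integrable.mono' h1 hm.aestronglyMeasurable ?_
    refine (ae_restrict_iff' measurableSet_Ioi).2 (Eventually.of_forall fun x hx => ?_)
    have hx0 : 0 < x := lt_trans one_pos hx
    have e1 : Real.exp (-x) ≤ 1 := Real.exp_le_one_iff.2 (by linarith)
    have e2 := Real.exp_pos (-x)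
    have hp : 0 ≤ x ^ (-1 - γ) := Real.rpow_nonneg hx0.le _
    rw [Real.norm_of_nonneg (mul_nonneg (by linarith) hp)]
    exact mul_le_of_le_one_left hp (by linarith)

lemma aux_integral (γ : ℝ) (hγ0 : 0 < γ) (hγ1 : γ < 1) :
    ∫ u in Ioi (0:ℝ), (1 - Real.exp (-u)) * u ^ (-1 - γ) = Real.Gamma (1 - γ) / γ := by
  have hG := Real.Gamma_eq_integral (s := 1 - γ) (by linarith)
  have hGi := Real.GammaIntegral_convergent (s := 1 - γ) (by linarith)
  have he : (1 - γ - 1) = -γ := by ring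
  rw [he] at hG hGi
  have key := integral_Ioi_mul_deriv_eq_deriv_mul (a := (0:ℝ)) (a' := (0:ℝ)) (b' := (0:ℝ))
    (u := fun x : ℝ => 1 - Real.exp (-x)) (u' := fun x : ℝ => Real.exp (-x))
    (v := fun x : ℝ => -(1/γ) * x ^ (-γ)) (v' := fun x : ℝ => x ^ (-1 - γ)) ?_ ?_ ?_ ?_ ?_ ?_
  · rw [key, hG]
    have : ∀ x : ℝ, Real.exp (-x) * (-(1/γ) * x ^ (-γ)) = -(1/γ) * (Real.exp (-x) * x ^ (-γ)) := by
      intro x; ring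
    simp only [this]
    rw [integral_const_mul]; ring
  · intro x _
    have := ((hasDerivAt_neg x).exp).const_sub 1
    simpa using this
  · intro x hx
    have := (Real.hasDerivAt_rpow_const (x := x) (p := -γ) (Or.inl (ne_of_gt hx))).const_mul (-(1/γ))
    convert this using 1
    rw [show -γ - 1 = -1 - γ by ring]
    field_simp
  · exact aux_integrable γ hγ0 hγ1
  · have := hGi.const_mul (-(1/γ))
    refine this.congr (Eventually.of_forall fun x => ?_)
    simp only [Pi.mul_apply]; ring
  · have h0 : Tendsto (fun x : ℝ => (1/γ) * x ^ (1 - γ)) (nhdsWithin 0 (Ioi 0)) (nhds 0) := by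
      have : ContinuousAt (fun x : ℝ => (1/γ) * x ^ (1 - γ)) 0 :=
        continuousAt_const.mul (Real.continuousAt_rpow_const _ _ (Or.inr (by linarith)))
      have h := this.tendsto
      rw [Real.zero_rpow (by linarith), mul_zero] at h
      exact h.mono_left nhdsWithin_le_nhds
    refine squeeze_zero_norm' ?_ h0
    filter_upwards [self_mem_nhdsWithin] with x hx
    have hx0 : 0 < x := hx
    have e1 : Real.exp (-x) ≤ 1 := Real.exp_le_one_iff.2 (by linarith)
    have e2 := Real.one_sub_le_exp_neg x
    have hp : 0 ≤ x ^ (-γ) := Real.rpow_nonneg hx0.le _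
    have hp2 : 0 < 1/γ := by positivity
    simp only [Pi.mul_apply]
    rw [show (1 - rexp (-x)) * (-(1 / γ) * x ^ (-γ)) = -((1/γ) * ((1 - rexp (-x)) * x ^ (-γ))) by ring,
      norm_neg, Real.norm_of_nonneg (mul_nonneg hp2.le (mul_nonneg (by linarith) hp))]
    have : x ^ (1-γ) = x * x ^ (- γ) := by
      nth_rewrite 2 [← Real.rpow_one x]
      rw [← Real.rpow_add hx0]; congr 1
    rw [this]
    exact mul_le_mul_of_nonneg_left (mul_le_mul_of_nonneg_right (by linarith) hp) hp2.le
  · have h0 := (tendsto_rpow_neg_atTop hγ0).const_mul (1/γ)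
    rw [mul_zero] at h0
    refine squeeze_zero_norm' ?_ h0
    filter_upwards [eventually_gt_atTop 0] with x hx0
    have e1 : Real.exp (-x) ≤ 1 := Real.exp_le_one_iff.2 (by linarith)
    have e2 := Real.exp_pos (-x)
    have hp : 0 ≤ x ^ (-γ) := Real.rpow_nonneg hx0.le _
    have hp2 : 0 < 1/γ := by positivity
    simp only [Pi.mul_apply]
    rw [show (1 - rexp (-x)) * (-(1 / γ) * x ^ (-γ)) = -((1/γ) * ((1 - rexp (-x)) * x ^ (-γ))) by ring,
      norm_neg, Real.norm_of_nonneg (mul_nonneg hp2.le (mul_nonneg (by linarith) hp))]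
    exact mul_le_mul_of_nonneg_left (mul_le_of_le_one_left hp (by linarith)) hp2.le

/-- a damped integrand is integrable -/
lemma aux_damped (φ : ℝ → ℝ) (hn : ∀ t, 0 < t → 0 ≤ φ t) (hi : IntegrableOn φ (Ioi 0))
    (s : ℝ) (hs : 0 < s) :
    IntegrableOn (fun t => (1 - Real.exp (-s * t)) * φ t) (Ioi 0) := by
  have hm : Measurable (fun t : ℝ => 1 - Real.exp (-s * t)) := by fun_prop
  refine Integrable.mono' hi (hm.aestronglyMeasurable.mul hi.aestronglyMeasurable) ?_
  refine (ae_restrict_iff' measurableSet_Ioi).2 (Eventually.of_forall fun x hx => ?_)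
  have hx0 : 0 < x := hx
  have e1 : Real.exp (-s * x) ≤ 1 := Real.exp_le_one_iff.2 (by nlinarith)
  have e2 := Real.exp_pos (-s * x)
  rw [Real.norm_of_nonneg (mul_nonneg (by linarith) (hn x hx0))]
  exact mul_le_of_le_one_left (hn x hx0) (by linarith)

/-- main part: bounded `h` -/
lemma aux_main (γ C M : ℝ) (hγ0 : 0 < γ) (hγ1 : γ < 1) (φ : ℝ → ℝ)
    (hn : ∀ t, 0 < t → 0 ≤ φ t) (hi : IntegrableOn φ (Ioi 0))
    (hb : ∀ t, 0 < t → t ^ (1 + γ) * φ t ≤ M)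
    (ht : Tendsto (fun t : ℝ => t ^ (1 + γ) * φ t) atTop (nhds C)) :
    Tendsto (fun s : ℝ => (∫ t in Ioi (0:ℝ), (1 - Real.exp (-s * t)) * φ t) / s ^ γ)
      (nhdsWithin 0 (Ioi 0)) (nhds (C * (Real.Gamma (1 - γ) / γ))) := by
  let G : ℝ → ℝ → ℝ := fun s u =>
    ((1 - Real.exp (-u)) * u ^ (-1 - γ)) * ((s⁻¹ * u) ^ (1 + γ) * φ (s⁻¹ * u))
  have hG : ∀ s, 0 < s → ∀ t ∈ Ioi (0:ℝ),
      G s (s * t) = s ^ (-1 - γ) * ((1 - Real.exp (-s * t)) * φ t) := by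
    intro s hs t ht
    have ht0 : 0 < t := ht
    simp only [G]
    rw [inv_mul_cancel_left₀ hs.ne', Real.mul_rpow hs.le ht0.le]
    have : t ^ (-1 - γ) * t ^ (1 + γ) = 1 := by
      rw [← Real.rpow_add ht0, show -1 - γ + (1 + γ) = 0 by ring, Real.rpow_zero]
    rw [show -(s * t) = -s * t by ring]
    linear_combination (1 - rexp (-s * t)) * s ^ (-1 - γ) * φ t * this
  have hGi : ∀ s, 0 < s → IntegrableOn (G s) (Ioi 0) := by
    intro s hs
    have := (integrableOn_Ioi_comp_mul_left_iff (G s) 0 hs).1 (by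
      refine IntegrableOn.congr_fun ((aux_damped φ hn hi s hs).const_mul (s ^ (-1 - γ))) ?_
        measurableSet_Ioi
      intro t ht
      exact (hG s hs t ht).symm)
    rwa [mul_zero] at this
  have hGint : ∀ s, 0 < s → ∫ u in Ioi (0:ℝ), G s u =
      (∫ t in Ioi (0:ℝ), (1 - Real.exp (-s * t)) * φ t) / s ^ γ := by
    intro s hs
    have h := integral_comp_mul_left_Ioi (G s) 0 hs
    rw [mul_zero, setIntegral_congr_fun measurableSet_Ioi (hG s hs), integral_const_mul,
      smul_eq_mul] at h
    have h2 : s ^ (-1 - γ) = s⁻¹ * (s ^ γ)⁻¹ := by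
      rw [Real.rpow_sub hs, Real.rpow_neg_one]; rfl
    rw [h2, mul_assoc] at h
    have := mul_left_cancel₀ (inv_ne_zero hs.ne') h
    rw [← this, div_eq_inv_mul]
  have hlim : Tendsto (fun s => ∫ u in Ioi (0:ℝ), G s u) (nhdsWithin 0 (Ioi 0))
      (nhds (∫ u in Ioi (0:ℝ), ((1 - Real.exp (-u)) * u ^ (-1 - γ)) * C)) := by
    refine tendsto_integral_filter_of_dominated_convergence
      (fun u => ((1 - Real.exp (-u)) * u ^ (-1 - γ)) * M) ?_ ?_
      ((aux_integrable γ hγ0 hγ1).mul_const M) ?_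
    · filter_upwards [self_mem_nhdsWithin] with s hs
      exact (hGi s hs).aestronglyMeasurable
    · filter_upwards [self_mem_nhdsWithin] with s hs
      refine (ae_restrict_iff' measurableSet_Ioi).2 (Eventually.of_forall fun x hx => ?_)
      have hx0 : 0 < x := hx
      have hs0 : 0 < s := hs
      have hxs : 0 < s⁻¹ * x := by positivity
      have e1 : Real.exp (-x) ≤ 1 := Real.exp_le_one_iff.2 (by linarith)
      have hp : 0 ≤ x ^ (-1 - γ) := Real.rpow_nonneg hx0.le _
      have hk : 0 ≤ (1 - Real.exp (-x)) * x ^ (-1 - γ) := mul_nonneg (by linarith) hp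
      simp only [G]
      rw [Real.norm_of_nonneg (mul_nonneg hk
        (mul_nonneg (Real.rpow_nonneg hxs.le _) (hn _ hxs)))]
      exact mul_le_mul_of_nonneg_left (hb _ hxs) hk
    · refine (ae_restrict_iff' measurableSet_Ioi).2 (Eventually.of_forall fun x hx => ?_)
      refine Tendsto.const_mul _ ?_
      exact ht.comp (tendsto_inv_nhdsGT_zero.atTop_mul_const hx)
  rw [integral_mul_const, aux_integral γ hγ0 hγ1, mul_comm] at hlim
  refine hlim.congr' ?_
  filter_upwards [self_mem_nhdsWithin] with s hs
  exact hGint s hs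

/-- Abelian theorem for heavy-tailed waiting times:
if `ψ(t) ~ (κ/τ)(t/τ)^{−1−γ}` as `t → ∞`, i.e. `t^{1+γ} ψ(t) → κ τ^γ`, then
`lim_{s→0+} (1 − L{ψ}(s))/s^γ = (κ Γ(1−γ)/γ) τ^γ`. -/
theorem abelian_heavy_tail
    (γ κ τ : ℝ) (hγ0 : 0 < γ) (hγ1 : γ < 1) (hκ : 0 < κ) (hτ : 0 < τ)
    (ψ : ℝ → ℝ)
    (hψ_nonneg : ∀ t, 0 ≤ t → 0 ≤ ψ t)
    (hψ_int : IntegrableOn ψ (Set.Ioi 0))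
    (hψ_norm : ∫ t in Set.Ioi (0 : ℝ), ψ t = 1)
    (htail : Tendsto (fun t : ℝ => t ^ (1 + γ) * ψ t) atTop (nhds (κ * τ ^ γ))) :
    Tendsto
      (fun s : ℝ =>
        (1 - ∫ t in Set.Ioi (0 : ℝ), Real.exp (-s * t) * ψ t) / s ^ γ)
      (nhdsWithin 0 (Set.Ioi 0))
      (nhds ((κ * Real.Gamma (1 - γ) / γ) * τ ^ γ)) := by
  have hCpos : 0 < κ * τ ^ γ := mul_pos hκ (Real.rpow_pos_of_pos hτ _)
  obtain ⟨T0, hT0⟩ := eventually_atTop.1 (htail.eventually (eventually_le_nhds (lt_add_one _)))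
  obtain ⟨T, hT, hTT⟩ : ∃ T : ℝ, 0 < T ∧ T0 ≤ T := ⟨max T0 1, by positivity, le_max_left _ _⟩
  let φ : ℝ → ℝ := (Ioi T).indicator ψ
  have hφgt : ∀ t, T < t → φ t = ψ t := fun t h => indicator_of_mem (s := Ioi T) h ψ
  have hφle : ∀ t, t ≤ T → φ t = 0 := fun t h => indicator_of_notMem (s := Ioi T) (by simpa using h) ψ
  have hφn : ∀ t, 0 < t → 0 ≤ φ t := by
    intro t h
    rcases le_or_gt t T with h1 | h1
    · rw [hφle t h1]
    · rw [hφgt t h1]; exact hψ_nonneg t h.le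
  have hφi : IntegrableOn φ (Ioi 0) := hψ_int.indicator measurableSet_Ioi
  have hmain := aux_main γ (κ * τ ^ γ) (κ * τ ^ γ + 1) hγ0 hγ1 φ hφn hφi (by
      intro t h
      rcases le_or_gt t T with h1 | h1
      · rw [hφle t h1]; linarith
      · rw [hφgt t h1]; exact hT0 t (by linarith)) (by
      refine htail.congr' ?_
      filter_upwards [eventually_gt_atTop T] with t h
      rw [hφgt t h])
  have hψn : ∀ t, 0 < t → 0 ≤ ψ t := fun t h => hψ_nonneg t h.le
  have hrest : Tendsto (fun s : ℝ => ((∫ t in Ioi (0:ℝ), (1 - Real.exp (-s * t)) * ψ t)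
      - ∫ t in Ioi (0:ℝ), (1 - Real.exp (-s * t)) * φ t) / s ^ γ)
      (nhdsWithin 0 (Ioi 0)) (nhds 0) := by
    have h0 : Tendsto (fun x : ℝ => T * x ^ (1 - γ)) (nhdsWithin 0 (Ioi 0)) (nhds 0) := by
      have : ContinuousAt (fun x : ℝ => T * x ^ (1 - γ)) 0 :=
        continuousAt_const.mul (Real.continuousAt_rpow_const _ _ (Or.inr (by linarith)))
      have h := this.tendsto
      rw [Real.zero_rpow (by linarith), mul_zero] at h
      exact h.mono_left nhdsWithin_le_nhds
    refine squeeze_zero' ?_ ?_ h0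
    · filter_upwards [self_mem_nhdsWithin] with s hs
      have hs0 : 0 < s := hs
      refine div_nonneg (sub_nonneg.2 ?_) (Real.rpow_nonneg hs0.le _)
      refine setIntegral_mono_on (aux_damped φ hφn hφi s hs) (aux_damped ψ hψn hψ_int s hs)
        measurableSet_Ioi ?_
      intro t ht
      have ht0 : 0 < t := ht
      have e1 : Real.exp (-s * t) ≤ 1 := Real.exp_le_one_iff.2 (by nlinarith)
      refine mul_le_mul_of_nonneg_left ?_ (by linarith)
      rcases le_or_gt t T with h1 | h1
      · rw [hφle t h1]; exact hψn t ht0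
      · rw [hφgt t h1]
    · filter_upwards [self_mem_nhdsWithin] with s hs
      have hs0 : 0 < s := hs
      rw [← integral_sub (aux_damped ψ hψn hψ_int s hs) (aux_damped φ hφn hφi s hs),
        Real.rpow_sub hs0, Real.rpow_one, ← mul_div_assoc]
      refine div_le_div_of_nonneg_right ?_ (Real.rpow_nonneg hs0.le _)
      have : T * s = ∫ t in Ioi (0:ℝ), (T * s) * ψ t := by
        rw [integral_const_mul, hψ_norm, mul_one]
      rw [this]
      refine setIntegral_mono_on ((aux_damped ψ hψn hψ_int s hs).sub (aux_damped φ hφn hφi s hs))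
        (hψ_int.const_mul _) measurableSet_Ioi ?_
      intro t ht
      have ht0 : 0 < t := ht
      have hp := hψn t ht0
      rcases le_or_gt t T with h1 | h1
      · rw [hφle t h1, mul_zero, sub_zero]
        refine mul_le_mul_of_nonneg_right ?_ hp
        have e2 := Real.one_sub_le_exp_neg (s * t)
        rw [← neg_mul] at e2
        nlinarith
      · rw [hφgt t h1, sub_self]; positivity
  have hsum := hmain.add hrest
  rw [show κ * τ ^ γ * (Real.Gamma (1 - γ) / γ) + 0 = κ * Real.Gamma (1 - γ) / γ * τ ^ γ by ring]
    at hsum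
  refine hsum.congr' ?_
  filter_upwards [self_mem_nhdsWithin] with s hs
  rw [← add_div, add_sub_cancel]
  congr 1
  have hd := aux_damped ψ hψn hψ_int s hs
  have h1 : ∫ t in Ioi (0:ℝ), Real.exp (-s * t) * ψ t
      = ∫ t in Ioi (0:ℝ), (ψ t - (1 - Real.exp (-s * t)) * ψ t) := by
    congr 1; funext t; ring
  rw [h1, integral_sub hψ_int hd, hψ_norm]; ring
end

section
/- Let ψ be a waiting-time density with survival probability Φ(t) = ∫_t^∞ ψ(t') dt', let 0 < γ < 1 and κ, τ > 0, and suppose lim_{t→∞} t^{1+γ} ψ(t) = κ τ^γ. Then lim_{s→0+} s^{1−γ} L{Φ}(s) = (κ Γ(1−γ)/γ) τ^γ, i.e. L{Φ}(s) ~ (κ Γ(1−γ)/γ) τ^γ s^{γ−1} as s → 0+. -/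
open Real Set Filter MeasureTheory

lemma aux_tail (γ L : ℝ) (hγ0 : 0 < γ) (ψ Φ : ℝ → ℝ)
    (hψ_int : IntegrableOn ψ (Set.Ioi 0))
    (hΦ : ∀ t, Φ t = ∫ t' in Set.Ioi t, ψ t')
    (htail : Tendsto (fun t : ℝ => t ^ (1 + γ) * ψ t) atTop (nhds L)) :
    Tendsto (fun t : ℝ => t ^ γ * Φ t) atTop (nhds (L / γ)) := by
  rw [Metric.tendsto_atTop] at htail ⊢
  intro ε hε
  obtain ⟨T, hT⟩ := htail (ε * γ / 2) (by positivity)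
  refine ⟨max T 1, fun t ht => ?_⟩
  have htT : T ≤ t := le_trans (le_max_left _ _) ht
  have ht1 : 1 ≤ t := le_trans (le_max_right _ _) ht
  have ht0 : 0 < t := by linarith
  have hI : IntegrableOn (fun x : ℝ => x ^ (-(1 + γ))) (Ioi t) :=
    integrableOn_Ioi_rpow_of_lt (by linarith) ht0
  have hv : ∫ x in Ioi t, x ^ (-(1 + γ)) = t ^ (-γ) / γ := by
    rw [integral_Ioi_rpow_of_lt (by linarith) ht0]
    rw [show -(1 + γ) + 1 = -γ by ring, neg_div_neg_eq]
  have hψt : IntegrableOn ψ (Ioi t) := hψ_int.mono_set (Ioi_subset_Ioi ht0.le)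
  have hb : ∀ x ∈ Ioi t, (L - ε * γ / 2) * x ^ (-(1 + γ)) ≤ ψ x ∧
      ψ x ≤ (L + ε * γ / 2) * x ^ (-(1 + γ)) := by
    intro x hx
    have hx0 : 0 < x := ht0.trans hx
    have h := hT x (htT.trans (le_of_lt hx))
    rw [Real.dist_eq, abs_lt] at h
    have hp : 0 < x ^ (1 + γ) := Real.rpow_pos_of_pos hx0 _
    rw [Real.rpow_neg hx0.le, ← div_eq_mul_inv, ← div_eq_mul_inv, div_le_iff₀ hp, le_div_iff₀ hp]
    constructor <;> nlinarith [h.1, h.2]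
  have h1 : (L - ε * γ / 2) * (t ^ (-γ) / γ) ≤ Φ t := by
    rw [hΦ, ← hv, ← integral_const_mul]
    exact setIntegral_mono_on (hI.const_mul _) hψt measurableSet_Ioi (fun x hx => (hb x hx).1)
  have h2 : Φ t ≤ (L + ε * γ / 2) * (t ^ (-γ) / γ) := by
    rw [hΦ, ← hv, ← integral_const_mul]
    exact setIntegral_mono_on hψt (hI.const_mul _) measurableSet_Ioi (fun x hx => (hb x hx).2)
  have hp : 0 < t ^ γ := Real.rpow_pos_of_pos ht0 _
  have e1 : ∀ c : ℝ, t ^ γ * (c * (t ^ (-γ) / γ)) = c / γ := by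
    intro c
    rw [Real.rpow_neg ht0.le]
    field_simp
  have h1' := mul_le_mul_of_nonneg_left h1 hp.le
  have h2' := mul_le_mul_of_nonneg_left h2 hp.le
  rw [e1] at h1' h2'
  have e2 : (L - ε * γ / 2) / γ = L / γ - ε / 2 := by field_simp
  have e3 : (L + ε * γ / 2) / γ = L / γ + ε / 2 := by field_simp
  rw [e2] at h1'
  rw [e3] at h2'
  rw [Real.dist_eq, abs_lt]
  constructor <;> linarith

/-- if the waiting-time density ψ has heavy tail `t^{1+γ} ψ(t) → κ τ^γ`,
then its survival probability Φ satisfies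
`lim_{s→0+} s^{1−γ} L{Φ}(s) = (κ Γ(1−γ)/γ) τ^γ`. -/
theorem survival_laplace_small_s_heavy_tail
    (γ κ τ : ℝ) (hγ0 : 0 < γ) (hγ1 : γ < 1) (hκ : 0 < κ) (hτ : 0 < τ)
    (ψ Φ : ℝ → ℝ)
    (hψ_nonneg : ∀ t, 0 ≤ t → 0 ≤ ψ t)
    (hψ_int : IntegrableOn ψ (Set.Ioi 0))
    (hψ_norm : ∫ t in Set.Ioi (0 : ℝ), ψ t = 1)
    (hΦ : ∀ t, Φ t = ∫ t' in Set.Ioi t, ψ t')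
    (htail : Tendsto (fun t : ℝ => t ^ (1 + γ) * ψ t) atTop (nhds (κ * τ ^ γ))) :
    Tendsto
      (fun s : ℝ =>
        s ^ (1 - γ) * ∫ t in Set.Ioi (0 : ℝ), Real.exp (-s * t) * Φ t)
      (nhdsWithin 0 (Set.Ioi 0))
      (nhds ((κ * Real.Gamma (1 - γ) / γ) * τ ^ γ)) := by
  set L := κ * τ ^ γ with hL
  have hlim := aux_tail γ L hγ0 ψ Φ hψ_int hΦ htail
  have hΦ0 : ∀ t, 0 ≤ t → 0 ≤ Φ t := by
    intro t ht
    rw [hΦ]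
    exact setIntegral_nonneg measurableSet_Ioi (fun x hx => hψ_nonneg x (ht.trans (le_of_lt hx)))
  have hanti : ∀ a b, 0 ≤ a → a ≤ b → Φ b ≤ Φ a := by
    intro a b ha hab
    rw [hΦ, hΦ]
    refine setIntegral_mono_set (hψ_int.mono_set (Ioi_subset_Ioi ha)) ?_
      (Ioi_subset_Ioi hab).eventuallyLE
    filter_upwards [ae_restrict_mem measurableSet_Ioi] with x hx
    exact hψ_nonneg x (ha.trans (le_of_lt hx))
  have hΦ1 : ∀ t, 0 ≤ t → Φ t ≤ 1 := by
    intro t ht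
    rw [← hψ_norm, ← hΦ]
    exact hanti 0 t le_rfl ht
  obtain ⟨M, hM⟩ : ∃ M, ∀ t, 0 < t → t ^ γ * Φ t ≤ M := by
    obtain ⟨T, hT⟩ := eventually_atTop.1 (hlim.eventually (gt_mem_nhds (lt_add_one (L / γ))))
    refine ⟨max (L / γ + 1) ((max T 0) ^ γ), fun t ht => ?_⟩
    rcases le_total T t with h | h
    · exact (hT t h).le.trans (le_max_left _ _)
    · refine le_trans ?_ (le_max_right _ _)
      calc t ^ γ * Φ t ≤ t ^ γ * 1 :=
            mul_le_mul_of_nonneg_left (hΦ1 t ht.le) (Real.rpow_nonneg ht.le _)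
        _ = t ^ γ := mul_one _
        _ ≤ _ := Real.rpow_le_rpow ht.le (h.trans (le_max_left _ _)) hγ0.le
  have hkey : ∀ s u : ℝ, 0 < s → 0 < u →
      s ^ (-γ) * Φ (u / s) = u ^ (-γ) * ((u / s) ^ γ * Φ (u / s)) := by
    intro s u hs hu
    rw [Real.div_rpow hu.le hs.le, Real.rpow_neg hs.le, Real.rpow_neg hu.le]
    have := Real.rpow_pos_of_pos hs γ
    have := Real.rpow_pos_of_pos hu γ
    field_simp
  have hval : (κ * Real.Gamma (1 - γ) / γ) * τ ^ γ
      = ∫ u in Ioi (0 : ℝ), (Real.exp (-u) * u ^ ((1 - γ) - 1)) * (L / γ) := by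
    rw [integral_mul_const, ← Real.Gamma_eq_integral (by linarith), hL]
    ring
  have hDCT : Tendsto (fun s : ℝ => ∫ u in Ioi (0 : ℝ), Real.exp (-u) * (s ^ (-γ) * Φ (u / s)))
      (nhdsWithin 0 (Ioi 0))
      (nhds (∫ u in Ioi (0 : ℝ), (Real.exp (-u) * u ^ ((1 - γ) - 1)) * (L / γ))) := by
    refine tendsto_integral_filter_of_dominated_convergence
      (fun u => (Real.exp (-u) * u ^ ((1 - γ) - 1)) * M) ?_ ?_ ?_ ?_
    · filter_upwards [self_mem_nhdsWithin] with s hs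
      have hs0 : 0 < s := hs
      have hm : AEMeasurable (fun u => Φ (u / s)) (volume.restrict (Ioi 0)) := by
        refine aemeasurable_restrict_of_antitoneOn measurableSet_Ioi ?_
        intro a ha b hb hab
        have ha0 : 0 < a := ha
        exact hanti _ _ (by positivity) (by gcongr)
      have he : AEMeasurable (fun u : ℝ => Real.exp (-u)) (volume.restrict (Ioi 0)) := by
        fun_prop
      exact (he.mul (hm.const_mul _)).aestronglyMeasurable
    · filter_upwards [self_mem_nhdsWithin] with s hs
      have hs0 : 0 < s := hs
      filter_upwards [ae_restrict_mem measurableSet_Ioi] with u hu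
      have hu0 : 0 < u := hu
      have h0 := hΦ0 (u / s) (by positivity)
      rw [Real.norm_of_nonneg (by positivity), hkey s u hs0 hu0, mul_assoc,
        show (1 - γ) - 1 = -γ by ring]
      have := hM (u / s) (by positivity)
      gcongr
    · exact (Real.GammaIntegral_convergent (by linarith)).mul_const _
    · filter_upwards [ae_restrict_mem measurableSet_Ioi] with u hu
      have hu0 : 0 < u := hu
      have ht : Tendsto (fun s : ℝ => u / s) (nhdsWithin 0 (Ioi 0)) atTop := by
        simp only [div_eq_mul_inv]
        exact tendsto_inv_nhdsGT_zero.const_mul_atTop hu0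
      have h2 := (hlim.comp ht).const_mul (Real.exp (-u) * u ^ ((1 - γ) - 1))
      refine h2.congr' ?_
      filter_upwards [self_mem_nhdsWithin] with s hs
      rw [hkey s u hs hu0, show (1 - γ) - 1 = -γ by ring]
      simp only [Function.comp]
      ring
  rw [hval]
  refine hDCT.congr' ?_
  filter_upwards [self_mem_nhdsWithin] with s hs
  have hs0 : 0 < s := hs
  have hc := integral_comp_mul_left_Ioi
    (fun u => Real.exp (-u) * (s ^ (-γ) * Φ (u / s))) 0 hs0
  rw [mul_zero, smul_eq_mul] at hc
  have h3 : ∫ x in Ioi (0 : ℝ), Real.exp (-(s * x)) * (s ^ (-γ) * Φ (s * x / s))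
      = s ^ (-γ) * ∫ t in Ioi (0 : ℝ), Real.exp (-s * t) * Φ t := by
    rw [← integral_const_mul]
    congr 1
    ext x
    rw [mul_div_cancel_left₀ _ hs0.ne', neg_mul]
    ring
  rw [h3] at hc
  rw [show 1 - γ = 1 + -γ by ring, Real.rpow_add hs0, Real.rpow_one, mul_assoc, hc,
    mul_inv_cancel_left₀ hs0.ne']
end

section
/- Let 0 < γ < 1 and τ > 0, and let ψ(t) = −(d/dt) E_γ(−(t/τ)^γ) be the Mittag-Leffler waiting-time density, where E_γ(z) = Σ_{n=0}^∞ z^n/Γ(γn+1). Then for every s > 1/τ, L{ψ}(s) = 1/(1 + (sτ)^γ), and consequently, with Φ(t) = ∫_t^∞ ψ(t') dt' the survival probability, the ratio of Laplace transforms satisfies exactly L{ψ}(s)/L{Φ}(s) = s^{1−γ}/τ^γ (i.e. A_γ = 1 for the Mittag-Leffler density). -/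
open Real Set MeasureTheory

lemma ml_Gamma_lower {R y : ℝ} (hR : 0 < R) (hy : 1 ≤ y) :
    Real.exp (-R) * R ^ (y - 1) ≤ Real.Gamma y := by
  rw [Real.Gamma_eq_integral (by linarith)]
  have h1 : ∫ x in Ioi R, Real.exp (-x) * R ^ (y-1) = Real.exp (-R) * R ^ (y - 1) := by
    rw [integral_mul_const, integral_exp_neg_Ioi]
  rw [← h1]
  have hi := Real.GammaIntegral_convergent (s := y) (by linarith)
  calc _ ≤ ∫ x in Ioi R, Real.exp (-x) * x ^ (y-1) := by
        apply setIntegral_mono_on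
        · exact (integrableOn_exp_neg_Ioi R).mul_const _
        · exact hi.mono_set (Ioi_subset_Ioi hR.le)
        · exact measurableSet_Ioi
        · intro x hx
          have : R ≤ x := le_of_lt hx
          gcongr
    _ ≤ _ := by
        apply setIntegral_mono_set hi
        · filter_upwards [ae_restrict_mem measurableSet_Ioi] with x hx
          have : 0 < x := hx
          simp only [Pi.zero_apply]
          positivity
        · exact (Ioi_subset_Ioi hR.le).eventuallyLE

lemma ml_summable {γ a : ℝ} (hγ : 0 < γ) (ha : 0 < a) (z : ℝ) :
    Summable fun n : ℕ => z ^ n / Real.Gamma (γ * n + a) := by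
  set Q : ℝ := 2 * (|z| + 1) with hQ
  have hQ0 : 0 < Q := by positivity
  set R : ℝ := Q ^ (1/γ) with hRdef
  have hR : 0 < R := by positivity
  have hRQ : R ^ γ = Q := by
    rw [hRdef, ← Real.rpow_mul hQ0.le]; field_simp; simp
  apply Summable.of_norm_bounded_eventually_nat (g := fun n : ℕ => (Real.exp R * R ^ (1 - a)) * (1/2:ℝ)^n)
  · exact (summable_geometric_of_lt_one (by norm_num) (by norm_num)).mul_left _
  · obtain ⟨N, hN⟩ := exists_nat_gt (1/γ)
    filter_upwards [Filter.eventually_ge_atTop N] with n hn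
    have hy : 1 ≤ γ * n + a := by
      have : (N:ℝ) ≤ n := by exact_mod_cast hn
      have h2 : 1 / γ < n := by linarith
      rw [div_lt_iff₀ hγ] at h2
      nlinarith
    have hG := ml_Gamma_lower hR hy
    have hG0 : 0 < Real.Gamma (γ * n + a) := Real.Gamma_pos_of_pos (by linarith)
    rw [norm_div, norm_pow, Real.norm_eq_abs, Real.norm_eq_abs, abs_of_pos hG0, div_le_iff₀ hG0]
    have e1 : R ^ (γ * n + a - 1) = Q ^ n * R ^ (a - 1) := by
      rw [add_sub_assoc, Real.rpow_add hR, Real.rpow_mul hR.le, hRQ, Real.rpow_natCast]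
    have e2 : R ^ (1 - a) * R ^ (a - 1) = 1 := by
      rw [← Real.rpow_add hR]; simp
    have e3 : Real.exp R * Real.exp (-R) = 1 := by
      rw [← Real.exp_add]; simp
    calc |z| ^ n ≤ ((1/2) * Q) ^ n := by
          gcongr
          rw [hQ]; linarith
      _ = (Real.exp R * Real.exp (-R)) * (R ^ (1 - a) * R ^ (a - 1)) * ((1/2) * Q) ^ n := by
          rw [e2, e3]; ring
      _ = Real.exp R * R ^ (1 - a) * (1/2)^n * (Real.exp (-R) * R ^ (γ * n + a - 1)) := by
          rw [e1, mul_pow]; ring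
      _ ≤ _ := by gcongr

noncomputable def mlH (γ a z : ℝ) : ℝ := ∑' n : ℕ, z ^ n / Real.Gamma (γ * n + a)

lemma mlH_continuous {γ a : ℝ} (hγ : 0 < γ) (ha : 0 < a) : Continuous (mlH γ a) := by
  rw [continuous_iff_continuousAt]
  intro z
  have : ContinuousOn (mlH γ a) (Metric.ball 0 (|z|+1)) := by
    unfold mlH
    apply continuousOn_tsum (u := fun n : ℕ => (|z|+1) ^ n / Real.Gamma (γ * n + a))
    · intro n; fun_prop
    · exact ml_summable hγ ha _
    · intro n x hx
      have hG0 : 0 < Real.Gamma (γ * n + a) := Real.Gamma_pos_of_pos (by positivity)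
      rw [norm_div, norm_pow, Real.norm_eq_abs (Real.Gamma _), abs_of_pos hG0]
      rw [mem_ball_zero_iff] at hx
      gcongr
  apply this.continuousAt
  apply Metric.isOpen_ball.mem_nhds
  simp

lemma ml_beta {a b t : ℝ} (ha : 0 < a) (hb : 0 < b) (ht : 0 < t) :
    ∫ u in (0:ℝ)..t, u ^ (a-1) * (t-u) ^ (b-1)
      = t ^ (a+b-1) * (Real.Gamma a * Real.Gamma b / Real.Gamma (a+b)) := by
  have h := Complex.betaIntegral_scaled (a:ℂ) (b:ℂ) ht
  rw [Complex.betaIntegral_eq_Gamma_mul_div _ _ (by simpa) (by simpa)] at h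
  rw [← Complex.ofReal_inj, ← intervalIntegral.integral_ofReal]
  push_cast
  rw [Complex.ofReal_cpow ht.le, ← Complex.Gamma_ofReal, ← Complex.Gamma_ofReal, ← Complex.Gamma_ofReal]
  push_cast
  rw [← h]
  apply intervalIntegral.integral_congr
  intro u hu
  rw [uIcc_of_le ht.le] at hu
  simp only
  rw [Complex.ofReal_cpow hu.1, Complex.ofReal_cpow (by linarith [hu.2])]
  push_cast
  rfl

lemma ml_beta_int {a b t : ℝ} (ha : 0 < a) (hb : 0 < b) (ht : 0 < t) :
    IntervalIntegrable (fun u => u ^ (a-1) * (t-u) ^ (b-1)) volume 0 t := by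
  apply intervalIntegral.intervalIntegrable_of_integral_ne_zero
  rw [ml_beta ha hb ht]
  have := Real.Gamma_pos_of_pos ha
  have := Real.Gamma_pos_of_pos hb
  have := Real.Gamma_pos_of_pos (add_pos ha hb)
  positivity

noncomputable def mlG (γ a t : ℝ) : ℝ := t ^ (a-1) * mlH γ a (-t ^ γ)

lemma mlG_shift {γ a t : ℝ} (hγ : 0 < γ) (ha : 0 < a) (ht : 0 < t) :
    mlG γ (a+γ) t = t ^ (a-1) / Real.Gamma a - mlG γ a t := by
  unfold mlG mlH
  rw [(ml_summable hγ ha (-t^γ)).tsum_eq_zero_add]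
  have e : t ^ (a + γ - 1) = t ^ (a-1) * t ^ γ := by
    rw [← Real.rpow_add ht]; ring_nf
  have : ∀ n : ℕ, (-t^γ)^(n+1) / Real.Gamma (γ * ((n+1:ℕ):ℝ) + a) =
      (-t^γ) * ((-t^γ)^n / Real.Gamma (γ * n + (a+γ))) := by
    intro n
    rw [show γ * ((n+1:ℕ):ℝ) + a = γ * n + (a+γ) by push_cast; ring]
    ring
  simp_rw [this, tsum_mul_left]
  rw [e]
  simp
  ring

lemma mlG_continuousOn {γ a : ℝ} (hγ : 0 < γ) (ha : 0 < a) :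
    ContinuousOn (mlG γ a) (Ioi 0) := by
  unfold mlG
  apply ContinuousOn.mul
  · intro x hx
    exact (Real.continuousAt_rpow_const _ _ (Or.inl (ne_of_gt hx))).continuousWithinAt
  · exact ((mlH_continuous hγ ha).comp ((Real.continuous_rpow_const hγ.le).neg)).continuousOn

lemma mlG_term {γ a t : ℝ} (ht : 0 < t) (n : ℕ) :
    t ^ (a-1) * ((-t^γ)^n / Real.Gamma (γ * n + a)) =
      (-1)^n / Real.Gamma (γ * n + a) * t ^ (γ * n + a - 1) := by
  have e : t ^ (γ * n + a - 1) = (t^γ)^n * t ^ (a-1) := by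
    rw [add_sub_assoc, Real.rpow_add ht, Real.rpow_mul ht.le, Real.rpow_natCast]
  rw [e, neg_pow (t^γ)]; ring

lemma mlG_conv_int {γ a b t : ℝ} (hγ : 0 < γ) (ha : 0 < a) (hb : 0 < b) (ht : 0 < t) :
    IntervalIntegrable (fun u => (t-u)^(b-1) * mlG γ a u) volume 0 t := by
  have := (ml_beta_int ha hb ht).mul_continuousOn (g := fun u => mlH γ a (-u^γ))
    ((mlH_continuous hγ ha).comp ((Real.continuous_rpow_const hγ.le).neg)).continuousOn
  refine this.congr ?_
  intro u hu
  simp only [mlG]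
  ring

lemma mlG_conv {γ a b t : ℝ} (hγ : 0 < γ) (ha : 0 < a) (hb : 0 < b) (ht : 0 < t) :
    ∫ u in (0:ℝ)..t, (t-u)^(b-1) * mlG γ a u = Real.Gamma b * mlG γ (a+b) t := by
  set F : ℕ → ℝ → ℝ := fun n u => (-1)^n / Real.Gamma (γ * n + a) *
    (u ^ (γ * n + a - 1) * (t-u)^(b-1)) with hF
  have hGa : ∀ n : ℕ, 0 < γ * n + a := fun n => by positivity
  have hval : ∀ n : ℕ, ∫ u in (0:ℝ)..t, (u ^ (γ * n + a - 1) * (t-u)^(b-1)) =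
      t ^ (γ * n + a + b - 1) * (Real.Gamma (γ * n + a) * Real.Gamma b / Real.Gamma (γ * n + a+b)) :=
    fun n => ml_beta (hGa n) hb ht
  have hint : ∀ n, Integrable (F n) (volume.restrict (Ioc 0 t)) := by
    intro n
    have := (ml_beta_int (hGa n) hb ht).const_mul ((-1)^n / Real.Gamma (γ * n + a))
    rwa [intervalIntegrable_iff_integrableOn_Ioc_of_le ht.le] at this
  have hG0 : ∀ n : ℕ, 0 < Real.Gamma (γ * n + a) := fun n => Real.Gamma_pos_of_pos (hGa n)
  have hnorm : ∀ n, ∫ u in Ioc 0 t, ‖F n u‖ = Real.Gamma b * t^(a+b-1) *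
      ((t^γ)^n / Real.Gamma (γ * n + (a+b))) := by
    intro n
    have : ∫ u in Ioc 0 t, ‖F n u‖ = ∫ u in Ioc 0 t, 1 / Real.Gamma (γ * n + a) *
        (u ^ (γ * n + a - 1) * (t-u)^(b-1)) := by
      apply setIntegral_congr_fun measurableSet_Ioc
      intro u hu
      have h1 : 0 ≤ u ^ (γ * n + a - 1) := Real.rpow_nonneg hu.1.le _
      have h2 : 0 ≤ (t-u) ^ (b - 1) := Real.rpow_nonneg (by linarith [hu.2]) _
      simp only [hF, norm_mul, norm_div, norm_pow, norm_neg, norm_one, one_pow, Real.norm_eq_abs,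
        abs_of_pos (hG0 n), abs_of_nonneg h1, abs_of_nonneg h2]
    rw [this, integral_const_mul, ← intervalIntegral.integral_of_le ht.le, hval]
    have e : t ^ (γ * n + a + b - 1) = (t^γ)^n * t ^ (a+b-1) := by
      rw [show γ * n + a + b - 1 = γ * n + (a + b - 1) by ring, Real.rpow_add ht,
        Real.rpow_mul ht.le, Real.rpow_natCast]
    rw [e, ← add_assoc]
    have := (hG0 n).ne'
    field_simp
  have hs := hasSum_integral_of_summable_integral_norm hint (by
    simp_rw [hnorm]
    exact (ml_summable hγ (add_pos ha hb) _).mul_left _)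
  have hsum : ∫ u in (0:ℝ)..t, (t-u)^(b-1) * mlG γ a u = ∫ u in Ioc 0 t, ∑' n, F n u := by
    rw [intervalIntegral.integral_of_le ht.le]
    apply setIntegral_congr_fun measurableSet_Ioc
    intro u hu
    simp only [mlG, mlH, hF]
    rw [← tsum_mul_left, ← tsum_mul_left]
    congr 1; ext n
    rw [mlG_term hu.1]; ring
  rw [hsum, ← hs.tsum_eq]
  unfold mlG mlH
  rw [← tsum_mul_left, ← tsum_mul_left]
  congr 1; ext n
  rw [mlG_term ht, integral_const_mul, ← intervalIntegral.integral_of_le ht.le, hval, ← add_assoc]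
  have := (hG0 n).ne'
  field_simp

lemma mlG_laplace {γ a s : ℝ} (hγ : 0 < γ) (ha : 0 < a) (hs : 1 < s) :
    ∫ t in Ioi (0:ℝ), Real.exp (-(s*t)) * mlG γ a t = s ^ (-a) / (1 + s ^ (-γ)) := by
  have hs0 : 0 < s := by linarith
  set F : ℕ → ℝ → ℝ := fun n u => (-1)^n / Real.Gamma (γ * n + a) *
    (u ^ (γ * n + a - 1) * Real.exp (-(s*u))) with hF
  have hGa : ∀ n : ℕ, 0 < γ * n + a := fun n => by positivity
  have hG0 : ∀ n : ℕ, 0 < Real.Gamma (γ * n + a) := fun n => Real.Gamma_pos_of_pos (hGa n)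
  have hval : ∀ n : ℕ, ∫ u in Ioi (0:ℝ), (u ^ (γ * n + a - 1) * Real.exp (-(s*u))) =
      s ^ (-a) * (s ^ (-γ))^n * Real.Gamma (γ * n + a) := by
    intro n
    rw [Real.integral_rpow_mul_exp_neg_mul_Ioi (hGa n) hs0, one_div, Real.inv_rpow hs0.le,
      ← Real.rpow_neg hs0.le, neg_add, Real.rpow_add hs0, ← neg_mul, Real.rpow_mul hs0.le, Real.rpow_natCast]
    ring
  have hint : ∀ n, Integrable (F n) (volume.restrict (Ioi 0)) := by
    intro n
    apply Integrable.const_mul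
    apply not_imp_comm.1 integral_undef
    rw [hval]
    have := hG0 n
    positivity
  have hlt : s ^ (-γ) < 1 := Real.rpow_lt_one_of_one_lt_of_neg hs (by linarith)
  have hpos : 0 < s ^ (-γ) := by positivity
  have hnorm : ∀ n, ∫ u in Ioi 0, ‖F n u‖ = s ^ (-a) * (s ^ (-γ))^n := by
    intro n
    have : ∫ u in Ioi 0, ‖F n u‖ = ∫ u in Ioi (0:ℝ), 1 / Real.Gamma (γ * n + a) *
        (u ^ (γ * n + a - 1) * Real.exp (-(s*u))) := by
      apply setIntegral_congr_fun measurableSet_Ioi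
      intro u hu
      have h1 : 0 ≤ u ^ (γ * n + a - 1) := Real.rpow_nonneg (le_of_lt hu) _
      simp only [hF, norm_mul, norm_div, norm_pow, norm_neg, norm_one, one_pow, Real.norm_eq_abs,
        abs_of_pos (hG0 n), abs_of_nonneg h1, Real.abs_exp]
    rw [this, integral_const_mul, hval]
    have := (hG0 n).ne'
    field_simp
  have hs' := hasSum_integral_of_summable_integral_norm hint (by
    simp_rw [hnorm]
    exact (summable_geometric_of_lt_one hpos.le hlt).mul_left _)
  have hsum : ∫ t in Ioi (0:ℝ), Real.exp (-(s*t)) * mlG γ a t = ∫ u in Ioi 0, ∑' n, F n u := by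
    apply setIntegral_congr_fun measurableSet_Ioi
    intro u hu
    simp only [mlG, mlH, hF]
    rw [← tsum_mul_left, ← tsum_mul_left]
    congr 1; ext n
    rw [mlG_term hu]; ring
  rw [hsum, ← hs'.tsum_eq]
  have : ∀ n, ∫ u in Ioi 0, F n u = s ^ (-a) * (-s ^ (-γ))^n := by
    intro n
    rw [integral_const_mul, hval, neg_pow (s ^ (-γ))]
    have := (hG0 n).ne'
    field_simp
  simp_rw [this, tsum_mul_left]
  rw [tsum_geometric_of_abs_lt_one (by rw [abs_neg, abs_of_pos hpos]; exact hlt), sub_neg_eq_add]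
  rfl

lemma ml_ker {γ c t : ℝ} (hγ : 0 < γ) :
    ∫ u in c..t, (t-u)^(γ-1) = (t-c)^γ/γ := by
  rw [intervalIntegral.integral_comp_sub_left (fun x => x^(γ-1)) t, integral_rpow (Or.inl (by linarith))]
  simp [Real.zero_rpow hγ.ne']

lemma ml_ker_int {γ c d t : ℝ} (hγ : 0 < γ) :
    IntervalIntegrable (fun u => (t-u)^(γ-1)) volume c d := by
  have := (intervalIntegral.intervalIntegrable_rpow' (a := t - c) (b := t - d) (r := γ - 1) (by linarith)).comp_sub_left t
  simpa using this

lemma mlG_renewal {γ t : ℝ} (hγ : 0 < γ) (ht : 0 < t) :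
    ∫ u in (0:ℝ)..t, (t-u)^(γ-1) * mlG γ γ u = t^(γ-1) - Real.Gamma γ * mlG γ γ t := by
  rw [mlG_conv hγ hγ hγ ht, mlG_shift hγ hγ ht]
  have := (Real.Gamma_pos_of_pos hγ).ne'
  field_simp

lemma mlG_pos {γ t : ℝ} (hγ : 0 < γ) (hγ1 : γ < 1) (ht : 0 < t) : 0 < mlG γ γ t := by
  by_contra hneg
  have hGpos := Real.Gamma_pos_of_pos hγ
  set q : ℝ → ℝ := fun t => mlH γ γ (-t ^ γ) with hq
  have hqc : Continuous q := (mlH_continuous hγ hγ).comp ((Real.continuous_rpow_const hγ.le).neg)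
  have hq0 : 0 < q 0 := by
    have : q 0 = 1 / Real.Gamma γ := by
      simp only [hq, mlH]
      rw [tsum_eq_single 0]
      · simp
      · intro n hn; simp [Real.zero_rpow hγ.ne', hn]
    rw [this]; positivity
  have hpq : ∀ t, 0 < t → (0 < mlG γ γ t ↔ 0 < q t) := by
    intro t ht
    have : 0 < t^(γ-1) := by positivity
    unfold mlG
    exact mul_pos_iff_of_pos_left this
  set S : Set ℝ := Ici 0 ∩ q ⁻¹' (Iic 0) with hS
  have hScl : IsClosed S := isClosed_Ici.inter (isClosed_Iic.preimage hqc)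
  have hSne : S.Nonempty := ⟨t, ht.le, by
    rw [hpq t ht] at hneg; simpa using hneg⟩
  have hSb : BddBelow S := ⟨0, fun x hx => hx.1⟩
  obtain ⟨t0, ht0S, ht0min⟩ : ∃ t0 ∈ S, ∀ x ∈ S, t0 ≤ x :=
    ⟨sInf S, hScl.csInf_mem hSne hSb, fun x hx => csInf_le hSb hx⟩
  have ht0 : 0 < t0 := by
    rcases (show (0:ℝ) ≤ t0 from ht0S.1).eq_or_lt with h | h
    · have := ht0S.2
      rw [← h] at this
      simp only [mem_preimage, mem_Iic] at this
      linarith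
    · exact h
  have hp0 : mlG γ γ t0 ≤ 0 := by
    have h1 := ht0S.2
    simp only [mem_preimage, mem_Iic] at h1
    by_contra h
    have := (hpq t0 ht0).1 (not_le.1 h)
    linarith
  have hpp : ∀ u, 0 < u → u < t0 → 0 < mlG γ γ u := by
    intro u hu hut
    rw [hpq u hu]
    by_contra h
    have := ht0min u ⟨hu.le, not_lt.1 h⟩
    linarith
  set x : ℝ := (γ * Real.Gamma γ / 4)^(1/γ) with hx
  have hx0 : 0 < x := by positivity
  have hxγ : x ^ γ = γ * Real.Gamma γ / 4 := by
    rw [hx, ← Real.rpow_mul (by positivity), one_div, inv_mul_cancel₀ hγ.ne', Real.rpow_one]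
  set δ := min (t0/2) x with hδ
  have hδ0 : 0 < δ := lt_min (by linarith) hx0
  have hδ1 : δ ≤ t0/2 := min_le_left _ _
  have hδ2 : δ ≤ x := min_le_right _ _
  obtain ⟨t1, ht1, hmax⟩ := isCompact_Icc.exists_isMaxOn (s := Icc (t0 - δ) t0) (f := mlG γ γ)
    ⟨t0, by constructor <;> linarith⟩ ((mlG_continuousOn hγ hγ).mono (by
      intro u hu; have := hu.1; simp only [mem_Ioi]; linarith))
  have hp1 : 0 < mlG γ γ t1 := by
    have h1 := hmax (show t0 - δ ∈ Icc (t0 - δ) t0 by constructor <;> linarith)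
    have h2 := hpp (t0 - δ) (by linarith) (by linarith)
    change mlG γ γ (t0 - δ) ≤ mlG γ γ t1 at h1
    linarith
  have ht1lt : t1 < t0 := by
    rcases ht1.2.eq_or_lt with h | h
    · rw [h] at hp1; linarith
    · exact h
  have ht1half : t0/2 ≤ t1 := by linarith [ht1.1]
  have ht1pos : 0 < t1 := by linarith
  have hI := mlG_conv_int (γ := γ) hγ hγ hγ ht0
  have hI0 : IntervalIntegrable (fun u => (t0-u)^(γ-1) * mlG γ γ u) volume 0 t1 :=
    hI.mono_set (by rw [uIcc_of_le ht1pos.le, uIcc_of_le ht0.le]; exact Icc_subset_Icc le_rfl ht1lt.le)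
  have hI1 : IntervalIntegrable (fun u => (t0-u)^(γ-1) * mlG γ γ u) volume t1 t0 :=
    hI.mono_set (by rw [uIcc_of_le ht1lt.le, uIcc_of_le ht0.le]; exact Icc_subset_Icc ht1pos.le le_rfl)
  have hsplit := intervalIntegral.integral_add_adjacent_intervals hI0 hI1
  rw [mlG_renewal hγ ht0] at hsplit
  have hA : ∫ u in (0:ℝ)..t1, (t0-u)^(γ-1) * mlG γ γ u ≤
      (t0/t1)^(γ-1) * (t1^(γ-1) - Real.Gamma γ * mlG γ γ t1) := by
    rw [← mlG_renewal hγ ht1pos, ← intervalIntegral.integral_const_mul]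
    apply intervalIntegral.integral_mono_on_of_le_Ioo ht1pos.le hI0
      ((mlG_conv_int hγ hγ hγ ht1pos).const_mul _)
    intro u hu
    have hu1 : 0 < t1 - u := by linarith [hu.2]
    have := hpp u hu.1 (by linarith [hu.2])
    rw [← mul_assoc]
    apply mul_le_mul_of_nonneg_right _ this.le
    rw [← Real.mul_rpow (by positivity) hu1.le]
    apply Real.rpow_le_rpow_of_nonpos (by positivity) _ (by linarith)
    rw [div_mul_eq_mul_div, div_le_iff₀ ht1pos]
    nlinarith [hu.1]
  have hB : ∫ u in t1..t0, (t0-u)^(γ-1) * mlG γ γ u ≤ (t0-t1)^γ/γ * mlG γ γ t1 := by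
    rw [← ml_ker hγ, ← intervalIntegral.integral_mul_const]
    apply intervalIntegral.integral_mono_on ht1lt.le hI1 ((ml_ker_int hγ).mul_const _)
    intro u hu
    have h1 : mlG γ γ u ≤ mlG γ γ t1 := hmax ⟨by linarith [hu.1, ht1.1], hu.2⟩
    have : 0 ≤ (t0-u)^(γ-1) := Real.rpow_nonneg (by linarith [hu.2]) _
    gcongr
  have e1 : (t0/t1)^(γ-1) * t1^(γ-1) = t0^(γ-1) := by
    rw [← Real.mul_rpow (by positivity) ht1pos.le]; congr 1; field_simp
  have e2 : (1/2:ℝ) ≤ (t0/t1)^(γ-1) := by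
    have h1 : (1/2:ℝ) = 2 ^ (-1:ℝ) := by rw [Real.rpow_neg_one]; norm_num
    calc (1/2:ℝ) = 2 ^ (-1:ℝ) := h1
      _ ≤ 2 ^ (γ-1) := Real.rpow_le_rpow_of_exponent_le (by norm_num) (by linarith)
      _ ≤ _ := by
        apply Real.rpow_le_rpow_of_nonpos (by positivity) _ (by linarith)
        rw [div_le_iff₀ ht1pos]; linarith
  have e3 : (t0-t1)^γ/γ ≤ Real.Gamma γ / 4 := by
    have : (t0-t1)^γ ≤ x^γ := by
      apply Real.rpow_le_rpow (by linarith) (by linarith [ht1.1]) hγ.le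
    rw [hxγ] at this
    rw [div_le_iff₀ hγ]; linarith
  have f1 : Real.Gamma γ * mlG γ γ t0 ≤ 0 := mul_nonpos_of_nonneg_of_nonpos hGpos.le hp0
  have hgp : 0 < Real.Gamma γ * mlG γ γ t1 := by positivity
  have f2 : (1/2) * (Real.Gamma γ * mlG γ γ t1) ≤ (t0/t1)^(γ-1) * (Real.Gamma γ * mlG γ γ t1) := by gcongr
  have f3 : (t0-t1)^γ/γ * mlG γ γ t1 ≤ Real.Gamma γ / 4 * mlG γ γ t1 := by gcongr
  rw [mul_sub, e1] at hA
  linarith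

/-- `F = mlG γ 1`. -/
lemma mlG_one_eq {γ t : ℝ} (hγ : 0 < γ) (ht : 0 < t) :
    mlG γ 1 t = 1 - ∫ u in (0:ℝ)..t, mlG γ γ u := by
  have h1 := mlG_conv (γ := γ) (a := γ) (b := 1) hγ hγ one_pos ht
  rw [add_comm γ 1, mlG_shift hγ one_pos ht] at h1
  simp at h1
  rw [h1]; ring

lemma mlG_ii {γ t : ℝ} (hγ : 0 < γ) (ht : 0 < t) : IntervalIntegrable (mlG γ γ) volume 0 t := by
  have := mlG_conv_int (γ := γ) (a := γ) (b := 1) hγ hγ one_pos ht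
  simpa using this

lemma mlG_one_deriv {γ t : ℝ} (hγ : 0 < γ) (ht : 0 < t) :
    HasDerivAt (mlG γ 1) (- mlG γ γ t) t := by
  have hc := mlG_continuousOn (γ := γ) hγ hγ
  have h := intervalIntegral.integral_hasDerivAt_right (mlG_ii hγ ht)
    (hc.stronglyMeasurableAtFilter isOpen_Ioi t ht) (hc.continuousAt (isOpen_Ioi.mem_nhds ht))
  refine (h.const_sub 1).congr_of_eventuallyEq ?_
  filter_upwards [isOpen_Ioi.mem_nhds ht] with x hx
  exact mlG_one_eq hγ hx

lemma mlG_one_anti {γ : ℝ} (hγ : 0 < γ) (hγ1 : γ < 1) : AntitoneOn (mlG γ 1) (Ioi 0) := by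
  apply antitoneOn_of_deriv_nonpos (convex_Ioi 0) (mlG_continuousOn hγ one_pos)
  · intro x hx
    rw [interior_Ioi] at hx
    exact (mlG_one_deriv hγ hx).differentiableAt.differentiableWithinAt
  · intro x hx
    rw [interior_Ioi] at hx
    rw [(mlG_one_deriv hγ hx).deriv]
    linarith [mlG_pos hγ hγ1 hx]

lemma mlG_one_le {γ t : ℝ} (hγ : 0 < γ) (hγ1 : γ < 1) (ht : 0 < t) : mlG γ 1 t ≤ 1 := by
  rw [mlG_one_eq hγ ht]
  have : 0 ≤ ∫ u in (0:ℝ)..t, mlG γ γ u := by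
    rw [intervalIntegral.integral_of_le ht.le]
    exact setIntegral_nonneg measurableSet_Ioc fun u hu => (mlG_pos hγ hγ1 hu.1).le
  linarith

lemma mlG_one_renewal {γ t : ℝ} (hγ : 0 < γ) (ht : 0 < t) :
    ∫ u in (0:ℝ)..t, (t-u)^(γ-1) * mlG γ 1 u = Real.Gamma γ * (1 - mlG γ 1 t) := by
  rw [mlG_conv hγ one_pos hγ ht, mlG_shift hγ one_pos ht]
  simp

lemma mlG_one_nonneg {γ t : ℝ} (hγ : 0 < γ) (hγ1 : γ < 1) (hT : 0 < t) : 0 ≤ mlG γ 1 t := by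
  by_contra hneg
  have hGpos := Real.Gamma_pos_of_pos hγ
  set c := - mlG γ 1 t with hc
  have hc0 : 0 < c := by linarith
  set d : ℝ := t / c ^ (1/γ) with hd
  have hd0 : 0 < d := by positivity
  have hdγ : c * d ^ γ = t ^ γ := by
    rw [hd, Real.div_rpow hT.le (by positivity), ← Real.rpow_mul hc0.le]
    field_simp; simp
  set r := t + d with hr
  have hr0 : 0 < r := by linarith
  have htr : t ≤ r := by linarith
  have hI := mlG_conv_int (γ := γ) hγ one_pos hγ hr0
  have hI0 : IntervalIntegrable (fun u => (r-u)^(γ-1) * mlG γ 1 u) volume 0 t :=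
    hI.mono_set (by rw [uIcc_of_le hT.le, uIcc_of_le hr0.le]; exact Icc_subset_Icc le_rfl htr)
  have hI1 : IntervalIntegrable (fun u => (r-u)^(γ-1) * mlG γ 1 u) volume t r :=
    hI.mono_set (by rw [uIcc_of_le htr, uIcc_of_le hr0.le]; exact Icc_subset_Icc hT.le le_rfl)
  have hsplit := intervalIntegral.integral_add_adjacent_intervals hI0 hI1
  rw [mlG_one_renewal hγ hr0] at hsplit
  have hA : ∫ u in (0:ℝ)..t, (r-u)^(γ-1) * mlG γ 1 u ≤ ∫ u in (0:ℝ)..t, (r-u)^(γ-1) := by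
    apply intervalIntegral.integral_mono_on_of_le_Ioo hT.le hI0 (ml_ker_int hγ)
    intro u hu
    have : 0 ≤ (r-u)^(γ-1) := Real.rpow_nonneg (by linarith [hu.2]) _
    exact mul_le_of_le_one_right this (mlG_one_le hγ hγ1 hu.1)
  have hA2 := intervalIntegral.integral_add_adjacent_intervals
    (ml_ker_int (c := 0) (d := t) (t := r) hγ) (ml_ker_int (c := t) (d := r) (t := r) hγ)
  rw [ml_ker hγ, ml_ker hγ] at hA2
  have hB : ∫ u in t..r, (r-u)^(γ-1) * mlG γ 1 u ≤ (r-t)^γ/γ * (-c) := by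
    rw [← ml_ker hγ, ← intervalIntegral.integral_mul_const]
    apply intervalIntegral.integral_mono_on htr hI1 ((ml_ker_int hγ).mul_const _)
    intro u hu
    have h1 : mlG γ 1 u ≤ -c := by
      rw [hc, neg_neg]
      exact mlG_one_anti hγ hγ1 hT (show 0 < u by linarith [hu.1]) hu.1
    have : 0 ≤ (r-u)^(γ-1) := Real.rpow_nonneg (by linarith [hu.2]) _
    gcongr
  have hsub : r ^ γ ≤ t ^ γ + d ^ γ := by
    rw [hr]
    exact Real.rpow_add_le_add_rpow hT.le hd0.le hγ.le hγ1.le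
  have hrt : r - t = d := by rw [hr]; ring
  rw [hrt] at hA2 hB
  rw [sub_zero] at hA2
  have hFr : mlG γ 1 r ≤ -c := by
    rw [hc, neg_neg]
    exact mlG_one_anti hγ hγ1 hT hr0 htr
  have k1 : r ^ γ / γ ≤ c * d ^ γ / γ + d ^ γ / γ := by
    rw [← add_div, hdγ]; gcongr
  have k2 : d ^ γ / γ * (-c) = - (c * d ^ γ / γ) := by ring
  rw [k2] at hB
  have : Real.Gamma γ * (1 - mlG γ 1 r) ≤ 0 := by linarith
  nlinarith

lemma mlG_one_tendsto {γ : ℝ} (hγ : 0 < γ) (hγ1 : γ < 1) :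
    Filter.Tendsto (mlG γ 1) Filter.atTop (nhds 0) := by
  have hGpos := Real.Gamma_pos_of_pos hγ
  have hb : Filter.Tendsto (fun t : ℝ => γ * Real.Gamma γ * t ^ (-γ)) Filter.atTop (nhds 0) := by
    simpa using (tendsto_rpow_neg_atTop hγ).const_mul (γ * Real.Gamma γ)
  refine tendsto_of_tendsto_of_tendsto_of_le_of_le' tendsto_const_nhds hb ?_ ?_
  · filter_upwards [Filter.eventually_gt_atTop 0] with t ht using mlG_one_nonneg hγ hγ1 ht
  · filter_upwards [Filter.eventually_gt_atTop 0] with t ht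
    have h : t^γ/γ * mlG γ 1 t ≤ ∫ u in (0:ℝ)..t, (t-u)^(γ-1) * mlG γ 1 u := by
      have := ml_ker (c := 0) (t := t) hγ
      rw [sub_zero] at this
      rw [← this, ← intervalIntegral.integral_mul_const]
      apply intervalIntegral.integral_mono_on_of_le_Ioo ht.le ((ml_ker_int hγ).mul_const _)
        (mlG_conv_int hγ one_pos hγ ht)
      intro u hu
      have h1 : mlG γ 1 t ≤ mlG γ 1 u := mlG_one_anti hγ hγ1 hu.1 ht hu.2.le
      have : 0 ≤ (t-u)^(γ-1) := Real.rpow_nonneg (by linarith [hu.2]) _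
      gcongr
    rw [mlG_one_renewal hγ ht] at h
    have h0 := mlG_one_nonneg hγ hγ1 ht
    rw [Real.rpow_neg ht.le, ← div_eq_mul_inv, le_div_iff₀ (by positivity)]
    rw [div_mul_eq_mul_div, div_le_iff₀ hγ] at h
    have : 0 ≤ Real.Gamma γ * mlG γ 1 t * γ := by positivity
    nlinarith

/-- for the Mittag-Leffler waiting-time density
`ψ(t) = −(d/dt) E_γ(−(t/τ)^γ)`, its Laplace transform is `1/(1 + (sτ)^γ)` for
`s > 1/τ`, and the ratio `L{ψ}(s)/L{Φ}(s)` equals exactly `s^{1−γ}/τ^γ`. -/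
theorem mittagLeffler_density_laplace
    (γ τ : ℝ) (hγ0 : 0 < γ) (hγ1 : γ < 1) (hτ : 0 < τ)
    (E : ℝ → ℝ) (hE : ∀ z : ℝ, E z = ∑' n : ℕ, z ^ n / Real.Gamma (γ * n + 1))
    (ψ Φ : ℝ → ℝ)
    (hψ : ∀ t, ψ t = -(deriv (fun t' : ℝ => E (-(t' / τ) ^ γ)) t))
    (hΦ : ∀ t, Φ t = ∫ t' in Set.Ioi t, ψ t') :
    ∀ s : ℝ, 1 / τ < s →
      (∫ t in Set.Ioi (0 : ℝ), Real.exp (-s * t) * ψ t) = 1 / (1 + (s * τ) ^ γ) ∧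
      ((∫ t in Set.Ioi (0 : ℝ), Real.exp (-s * t) * ψ t) /
        (∫ t in Set.Ioi (0 : ℝ), Real.exp (-s * t) * Φ t))
          = s ^ (1 - γ) / τ ^ γ := by
  intro s hs
  have hs0 : 0 < s := lt_trans (by positivity) hs
  have hsτ : 1 < s * τ := by rwa [div_lt_iff₀ hτ] at hs
  have hsτ0 : 0 < s * τ := by positivity
  have hEG : (fun t' : ℝ => E (-(t' / τ) ^ γ)) = fun t' => mlG γ 1 (t' / τ) := by
    ext t; rw [hE]; simp [mlG, mlH]
  have hd : ∀ t, 0 < t → HasDerivAt (fun t' => mlG γ 1 (t' / τ)) (-(τ⁻¹ * mlG γ γ (τ⁻¹ * t))) t := by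
    intro t ht
    have h1 : HasDerivAt (fun t' : ℝ => t' / τ) (1/τ) t := (hasDerivAt_id t).div_const τ
    have h2 := (mlG_one_deriv hγ0 (div_pos ht hτ)).comp t h1
    have e : -(τ⁻¹ * mlG γ γ (τ⁻¹ * t)) = -mlG γ γ (t / τ) * (1 / τ) := by
      rw [div_eq_inv_mul t τ]; ring
    rw [e]; exact h2
  have hψ' : ∀ t, 0 < t → ψ t = τ⁻¹ * mlG γ γ (τ⁻¹ * t) := by
    intro t ht
    rw [hψ, hEG, (hd t ht).deriv, neg_neg]
  have hΦ' : ∀ t, 0 < t → Φ t = mlG γ 1 (τ⁻¹ * t) := by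
    intro t ht
    have h := integral_Ioi_of_hasDerivAt_of_nonpos' (a := t)
      (g := fun t' => mlG γ 1 (t' / τ)) (g' := fun t => -(τ⁻¹ * mlG γ γ (τ⁻¹ * t))) (l := 0)
      (fun x hx => hd x (lt_of_lt_of_le ht hx))
      (fun x hx => by
        have hx0 : 0 < x := lt_trans ht hx
        have := mlG_pos hγ0 hγ1 (show 0 < τ⁻¹ * x by positivity)
        simp only [Left.neg_nonpos_iff]
        positivity)
      ((mlG_one_tendsto hγ0 hγ1).comp (Filter.tendsto_id.atTop_div_const hτ))
    rw [integral_neg] at h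
    rw [hΦ, setIntegral_congr_fun measurableSet_Ioi (fun x hx => hψ' x (lt_trans ht hx))]
    rw [div_eq_inv_mul] at h
    linarith
  have hscale : ∀ a, 0 < a → ∫ t in Ioi (0:ℝ), Real.exp (-s * t) * mlG γ a (τ⁻¹ * t)
      = τ * ((s*τ) ^ (-a) / (1 + (s*τ) ^ (-γ))) := by
    intro a ha
    have h := integral_comp_mul_left_Ioi
      (fun x => Real.exp (-(s*τ*x)) * mlG γ a x) 0 (inv_pos.2 hτ)
    rw [mul_zero, mlG_laplace hγ0 ha hsτ, inv_inv, smul_eq_mul] at h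
    rw [← h]
    congr 1; ext t
    congr 2
    field_simp
  have hLψ : (∫ t in Set.Ioi (0 : ℝ), Real.exp (-s * t) * ψ t)
      = (s*τ) ^ (-γ) / (1 + (s*τ) ^ (-γ)) := by
    rw [setIntegral_congr_fun (g := fun t => τ⁻¹ * (Real.exp (-s * t) * mlG γ γ (τ⁻¹ * t)))
      measurableSet_Ioi (fun x hx => by
        simp only
        rw [hψ' x hx]; ring), integral_const_mul, hscale γ hγ0]
    field_simp
  have hLΦ : (∫ t in Set.Ioi (0 : ℝ), Real.exp (-s * t) * Φ t)
      = τ * ((s*τ) ^ (-1:ℝ) / (1 + (s*τ) ^ (-γ))) := by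
    rw [← hscale 1 one_pos]
    apply setIntegral_congr_fun measurableSet_Ioi
    intro x hx
    simp only
    rw [hΦ' x hx]
  have hp : 0 < (s*τ)^γ := by positivity
  constructor
  · rw [hLψ, Real.rpow_neg hsτ0.le]
    field_simp
    ring
  · rw [hLψ, hLΦ, Real.rpow_neg hsτ0.le, Real.rpow_neg_one, Real.rpow_sub hs0, Real.rpow_one,
      Real.mul_rpow hs0.le hτ.le]
    have : 0 < s^γ := by positivity
    have : 0 < τ^γ := by positivity
    field_simp
end

section
/- (Model III loss flux in Laplace space.) Let ψ be a waiting-time density with survival probability Φ, let n₀ ∈ ℝ, and let n, J : [0,∞) → ℝ with n locally absolutely continuous, n(0) = n₀, such that for some s > 0 the functions t ↦ e^{−st}|J(t)|, t ↦ e^{−st}|n(t)| and t ↦ e^{−st}|n'(t)| are integrable and e^{−st} n(t) → 0 as t → ∞. If the loss flux satisfies J(t) = ψ(t) n₀ + ∫_0^t ψ(t−t') [J(t') + n'(t')] dt' for almost every t ≥ 0, then L{J}(s) = (L{ψ}(s)/L{Φ}(s)) L{n}(s). -/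
open Real Set Filter MeasureTheory

lemma exists_max_aemeas (h : ℝ → ℝ) : ∃ A : Set ℝ, MeasurableSet A ∧
    AEMeasurable h (volume.restrict A) ∧
    ∀ C : Set ℝ, MeasurableSet C → AEMeasurable h (volume.restrict C) → volume (C \ A) = 0 := by
  set ν : Measure ℝ := (volume : Measure ℝ).toFinite with hν
  let S : Set ENNReal := ν '' {A | MeasurableSet A ∧ AEMeasurable h (volume.restrict A)}
  have hS : S.Nonempty := ⟨ν ∅, ∅, ⟨MeasurableSet.empty, by simp⟩, rfl⟩
  obtain ⟨u, -, hu, huS⟩ := exists_seq_tendsto_sSup hS (OrderTop.bddAbove S)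
  choose A hA hAu using huS
  refine ⟨⋃ i, A i, MeasurableSet.iUnion fun i => (hA i).1,
    AEMeasurable.iUnion fun i => (hA i).2, fun C hC hCm => ?_⟩
  have hAm : MeasurableSet (⋃ i, A i) := MeasurableSet.iUnion fun i => (hA i).1
  have h1 : sSup S ≤ ν (⋃ i, A i) := by
    refine le_of_tendsto' hu fun i => ?_
    rw [← hAu]
    exact measure_mono (subset_iUnion A i)
  have h2 : ν ((⋃ i, A i) ∪ C) ≤ sSup S := by
    apply le_sSup
    refine ⟨_, ⟨hAm.union hC, ?_⟩, rfl⟩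
    rw [aemeasurable_union_iff]
    exact ⟨AEMeasurable.iUnion fun i => (hA i).2, hCm⟩
  have h3 : ν (C \ ⋃ i, A i) = 0 := by
    have h4 : ν ((⋃ i, A i) ∪ C) = ν (⋃ i, A i) + ν (C \ ⋃ i, A i) := by
      rw [← measure_union disjoint_sdiff_right (hC.diff hAm), union_sdiff_self]
    have h5 : ν (⋃ i, A i) + ν (C \ ⋃ i, A i) ≤ ν (⋃ i, A i) + 0 := by
      rw [← h4, add_zero]; exact h2.trans h1
    have := (ENNReal.add_le_add_iff_left (measure_ne_top ν _)).1 h5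
    simpa using this
  exact absolutelyContinuous_toFinite _ h3

lemma conv_meas (p h : ℝ → ℝ) (hp : Measurable p) :
    Measurable (fun t => ∫ u, p (t - u) * h u) := by
  classical
  obtain ⟨A, hA, hhA, hmax⟩ := exists_max_aemeas h
  have hk := (aemeasurable_indicator_iff hA).2 hhA
  set k := hk.mk _ with hkdef
  have hkm : Measurable k := hk.measurable_mk
  have hkeq : A.indicator h =ᵐ[volume] k := hk.ae_eq_mk
  let T : Set (ℝ × ℝ) := {q | p (q.1 - q.2) ≠ 0 ∧ q.2 ∉ A}
  have hp2 : Measurable (fun q : ℝ × ℝ => p (q.1 - q.2)) := hp.comp (by fun_prop)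
  have hT : MeasurableSet T :=
    (hp2 (measurableSet_singleton 0).compl).inter (measurable_snd hA.compl)
  have hm : Measurable (fun t : ℝ => (volume : Measure ℝ) (Prod.mk t ⁻¹' T)) :=
    measurable_measure_prodMk_left hT
  have hG : Measurable (fun t : ℝ => ∫ u, p (t - u) * k u) := by
    have : StronglyMeasurable (fun q : ℝ × ℝ => p (q.1 - q.2) * k q.2) :=
      (hp2.mul (hkm.comp measurable_snd)).stronglyMeasurable
    exact this.integral_prod_right.measurable
  have key : (fun t => ∫ u, p (t - u) * h u) = fun t =>
      if t ∈ {t : ℝ | (volume : Measure ℝ) (Prod.mk t ⁻¹' T) = 0} then ∫ u, p (t - u) * k u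
        else 0 := by
    funext t
    split_ifs with ht
    · apply integral_congr_ae
      have h0 : ∀ᵐ u : ℝ, u ∉ Prod.mk t ⁻¹' T := measure_eq_zero_iff_ae_notMem.1 ht
      filter_upwards [h0, hkeq] with u hu hku
      by_cases hpu : p (t - u) = 0
      · simp [hpu]
      · have huA : u ∈ A := by
          by_contra hc
          exact hu ⟨hpu, hc⟩
        rw [← hku, indicator_of_mem huA]
    · apply integral_undef
      intro hint
      apply ht
      have hpt : Measurable (fun u => p (t - u)) := hp.comp (by fun_prop)
      have hC : MeasurableSet {u | p (t - u) ≠ 0} := hpt (measurableSet_singleton 0).compl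
      refine hmax _ hC ?_
      have h1 : AEMeasurable (fun u => (p (t - u))⁻¹ * (p (t - u) * h u)) volume :=
        hpt.inv.aemeasurable.mul hint.aestronglyMeasurable.aemeasurable
      refine h1.restrict.congr ?_
      filter_upwards [ae_restrict_mem hC] with u hu
      exact inv_mul_cancel_left₀ hu _
  rw [key]
  exact Measurable.ite (hm (measurableSet_singleton 0)) hG measurable_const

lemma conv_meas' (ψ h : ℝ → ℝ) (hψ : AEMeasurable ψ (volume.restrict (Ioi 0))) :
    AEMeasurable (fun t => ∫ u in (0:ℝ)..t, ψ (t - u) * h u) (volume.restrict (Ioi 0)) := by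
  have hk := (aemeasurable_indicator_iff measurableSet_Ioi).2 hψ
  have h0 := conv_meas (hk.mk _) ((Ioi 0).indicator h) hk.measurable_mk
  refine h0.aemeasurable.congr ?_
  filter_upwards [ae_restrict_mem measurableSet_Ioi] with t ht
  have := congrFun (posConvolution_eq_convolution_indicator h ψ (ContinuousLinearMap.mul ℝ ℝ)
    volume) t
  rw [posConvolution, indicator_of_mem ht, convolution] at this
  simp only [ContinuousLinearMap.mul_apply'] at this
  simp only [mul_comm (ψ _)]
  rw [this]
  apply integral_congr_ae
  have h2 : Tendsto (fun u => t - u) (ae volume) (ae volume) :=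
    (Measure.measurePreserving_sub_left volume t).quasiMeasurePreserving.tendsto_ae
  filter_upwards [h2.eventually hk.ae_eq_mk] with u hu
  rw [← hu, mul_comm]

lemma lap_conv (s : ℝ) (f g : ℝ → ℝ)
    (hf : IntegrableOn (fun t => Real.exp (-s * t) * f t) (Ioi 0))
    (hg : IntegrableOn (fun t => Real.exp (-s * t) * g t) (Ioi 0)) :
    IntegrableOn (fun t => Real.exp (-s * t) * ∫ u in (0:ℝ)..t, f (t - u) * g u) (Ioi 0) ∧
    ∫ t in Ioi (0:ℝ), Real.exp (-s * t) * (∫ u in (0:ℝ)..t, f (t - u) * g u) =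
      (∫ t in Ioi (0:ℝ), Real.exp (-s * t) * f t) *
      ∫ t in Ioi (0:ℝ), Real.exp (-s * t) * g t := by
  have e : ∀ t, Real.exp (-s * t) * (∫ u in (0:ℝ)..t, f (t - u) * g u) =
      ∫ u in (0:ℝ)..t, ContinuousLinearMap.mul ℝ ℝ (Real.exp (-s * u) * g u)
        (Real.exp (-s * (t - u)) * f (t - u)) := by
    intro t
    rw [← intervalIntegral.integral_const_mul]
    congr 1
    funext u
    have : Real.exp (-s * t) = Real.exp (-s * u) * Real.exp (-s * (t - u)) := by
      rw [← Real.exp_add]; congr 1; ring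
    simp only [ContinuousLinearMap.mul_apply', this]
    ring
  simp only [e]
  constructor
  · have := integrable_posConvolution hg hf (ContinuousLinearMap.mul ℝ ℝ)
    rw [posConvolution, integrable_indicator_iff measurableSet_Ioi] at this
    exact this
  · rw [integral_posConvolution hg hf (ContinuousLinearMap.mul ℝ ℝ),
      ContinuousLinearMap.mul_apply', mul_comm]

lemma int_of_abs (s : ℝ) (f : ℝ → ℝ) (hf : AEMeasurable f (volume.restrict (Ioi 0)))
    (h : IntegrableOn (fun t => Real.exp (-s * t) * |f t|) (Ioi 0)) :
    IntegrableOn (fun t => Real.exp (-s * t) * f t) (Ioi 0) := by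
  refine Integrable.mono h ?_ ?_
  · have : Measurable (fun t : ℝ => Real.exp (-s * t)) := by fun_prop
    exact (this.aemeasurable.mul hf).aestronglyMeasurable
  · exact Eventually.of_forall fun t => by simp

/-- Model III loss flux in Laplace space: if the loss flux satisfies
`J(t) = ψ(t) n₀ + ∫_0^t ψ(t−t')[J(t') + n'(t')] dt'` a.e., with `n` locally absolutely
continuous (formalized as the integral of a locally integrable derivative `n'`),
then `L{J}(s) = (L{ψ}(s)/L{Φ}(s)) L{n}(s)`. -/
theorem modelIII_loss_flux_laplace
    (ψ Φ : ℝ → ℝ)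
    (hψ_nonneg : ∀ t, 0 ≤ t → 0 ≤ ψ t)
    (hψ_int : IntegrableOn ψ (Set.Ioi 0))
    (hψ_norm : ∫ t in Set.Ioi (0 : ℝ), ψ t = 1)
    (hΦ : ∀ t, Φ t = ∫ t' in Set.Ioi t, ψ t')
    (n₀ : ℝ) (n n' J : ℝ → ℝ)
    (hn'_loc : LocallyIntegrableOn n' (Set.Ici 0))
    (hn_ac : ∀ t : ℝ, 0 ≤ t → n t = n₀ + ∫ u in (0 : ℝ)..t, n' u)
    (hn0 : n 0 = n₀)
    (s : ℝ) (hs : 0 < s)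
    (hJ_int : IntegrableOn (fun t => Real.exp (-s * t) * |J t|) (Set.Ioi 0))
    (hn_int : IntegrableOn (fun t => Real.exp (-s * t) * |n t|) (Set.Ioi 0))
    (hn'_int : IntegrableOn (fun t => Real.exp (-s * t) * |n' t|) (Set.Ioi 0))
    (hdecay : Tendsto (fun t => Real.exp (-s * t) * n t) atTop (nhds 0))
    (hflux : ∀ᵐ t ∂(volume.restrict (Set.Ioi (0 : ℝ))),
      J t = ψ t * n₀ + ∫ t' in (0 : ℝ)..t, ψ (t - t') * (J t' + n' t')) :
    (∫ t in Set.Ioi (0 : ℝ), Real.exp (-s * t) * J t)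
      = ((∫ t in Set.Ioi (0 : ℝ), Real.exp (-s * t) * ψ t) /
          (∫ t in Set.Ioi (0 : ℝ), Real.exp (-s * t) * Φ t)) *
        (∫ t in Set.Ioi (0 : ℝ), Real.exp (-s * t) * n t) := by
  have hψm : AEMeasurable ψ (volume.restrict (Ioi 0)) := hψ_int.aestronglyMeasurable.aemeasurable
  have hn'm : AEMeasurable n' (volume.restrict (Ioi 0)) :=
    (hn'_loc.aestronglyMeasurable.aemeasurable).mono_measure
      (Measure.restrict_mono Ioi_subset_Ici_self le_rfl)
  have hJm : AEMeasurable J (volume.restrict (Ioi 0)) :=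
    ((hψm.mul_const n₀).add (conv_meas' ψ (fun u => J u + n' u) hψm)).congr
      (hflux.mono fun t ht => ht.symm)
  have hJ := int_of_abs s J hJm hJ_int
  have hN' := int_of_abs s n' hn'm hn'_int
  have hE : IntegrableOn (fun t => Real.exp (-s * t)) (Ioi 0) :=
    integrableOn_exp_mul_Ioi (by linarith) 0
  have hEv : ∫ t in Ioi (0:ℝ), Real.exp (-s * t) = 1 / s := by
    rw [integral_exp_mul_Ioi (by linarith)]
    simp
  have hP : IntegrableOn (fun t => Real.exp (-s * t) * ψ t) (Ioi 0) := by
    refine Integrable.mono hψ_int ?_ ?_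
    · have : Measurable (fun t : ℝ => Real.exp (-s * t)) := by fun_prop
      exact (this.aemeasurable.mul hψm).aestronglyMeasurable
    · filter_upwards [ae_restrict_mem measurableSet_Ioi] with t ht
      rw [norm_mul, Real.norm_eq_abs, Real.abs_exp]
      have ht' : (0:ℝ) < t := ht
      have : Real.exp (-s * t) ≤ 1 := Real.exp_le_one_iff.2 (by nlinarith)
      exact mul_le_of_le_one_left (norm_nonneg _) this
  have hE1 : IntegrableOn (fun t => Real.exp (-s * t) * (fun _ : ℝ => (1:ℝ)) t) (Ioi 0) := by
    simpa using hE
  have hH : IntegrableOn (fun t => Real.exp (-s * t) * (fun u => J u + n' u) t) (Ioi 0) := by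
    refine (hJ.add hN').congr (Eventually.of_forall fun t => ?_)
    simp [mul_add]
  have hHv : ∫ t in Ioi (0:ℝ), Real.exp (-s * t) * (J t + n' t) =
      (∫ t in Ioi (0:ℝ), Real.exp (-s * t) * J t) + ∫ t in Ioi (0:ℝ), Real.exp (-s * t) * n' t := by
    rw [← integral_add hJ hN']
    simp only [mul_add]
  obtain ⟨c1, c2⟩ := lap_conv s ψ (fun u => J u + n' u) hP hH
  obtain ⟨d1, d2⟩ := lap_conv s (fun _ => 1) n' hE1 hN'
  obtain ⟨e1, e2⟩ := lap_conv s (fun _ => 1) ψ hE1 hP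
  simp only [one_mul, mul_one, hEv] at d1 d2 e1 e2
  simp only [hHv] at c2
  have eqJ : ∫ t in Ioi (0:ℝ), Real.exp (-s * t) * J t =
      (∫ t in Ioi (0:ℝ), Real.exp (-s * t) * ψ t) * n₀ +
      ∫ t in Ioi (0:ℝ), Real.exp (-s * t) *
        (∫ u in (0:ℝ)..t, ψ (t - u) * (J u + n' u)) := by
    rw [← integral_mul_const, ← integral_add (hP.mul_const n₀) c1]
    apply integral_congr_ae
    filter_upwards [hflux] with t ht
    conv_lhs => rw [ht]
    ring
  have eqn : ∫ t in Ioi (0:ℝ), Real.exp (-s * t) * n t =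
      1 / s * n₀ + ∫ t in Ioi (0:ℝ), Real.exp (-s * t) * (∫ u in (0:ℝ)..t, n' u) := by
    rw [← hEv, ← integral_mul_const, ← integral_add (hE.mul_const n₀) d1]
    apply setIntegral_congr_fun measurableSet_Ioi
    intro t ht
    simp only [hn_ac t (le_of_lt ht)]
    ring
  have eqΦ : ∫ t in Ioi (0:ℝ), Real.exp (-s * t) * Φ t =
      1 / s - ∫ t in Ioi (0:ℝ), Real.exp (-s * t) * (∫ u in (0:ℝ)..t, ψ u) := by
    rw [← hEv, ← integral_sub hE e1]
    apply setIntegral_congr_fun measurableSet_Ioi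
    intro t ht
    have ht' : (0:ℝ) ≤ t := le_of_lt ht
    have : Φ t = 1 - ∫ u in (0:ℝ)..t, ψ u := by
      rw [hΦ, intervalIntegral.integral_of_le ht', ← hψ_norm, ← Ioc_union_Ioi_eq_Ioi ht',
        setIntegral_union (Ioc_disjoint_Ioi le_rfl) measurableSet_Ioi
          (hψ_int.mono_set Ioc_subset_Ioi_self) (hψ_int.mono_set (Ioi_subset_Ioi ht'))]
      ring
    simp only [this]
    ring
  have hne : (1:ℝ) - ∫ t in Ioi (0:ℝ), Real.exp (-s * t) * ψ t ≠ 0 := by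
    rw [← hψ_norm, ← integral_sub hψ_int hP]
    intro h0
    have hi : IntegrableOn (fun a => ψ a - Real.exp (-s * a) * ψ a) (Ioi 0) := hψ_int.sub hP
    rw [setIntegral_eq_zero_iff_of_nonneg_ae ?_ hi] at h0
    · have hz : ∫ t in Ioi (0:ℝ), ψ t = 0 := by
        apply integral_eq_zero_of_ae
        filter_upwards [h0, ae_restrict_mem measurableSet_Ioi] with t h1 ht
        have ht' : (0:ℝ) < t := ht
        have h2 : Real.exp (-s * t) < 1 := Real.exp_lt_one_iff.2 (by nlinarith)
        have h3 : (1 - Real.exp (-s * t)) * ψ t = 0 := by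
          simp only [Pi.zero_apply] at h1
          linarith
        rcases mul_eq_zero.1 h3 with h | h
        · linarith
        · exact h
      rw [hz] at hψ_norm
      exact zero_ne_one hψ_norm
    · filter_upwards [ae_restrict_mem measurableSet_Ioi] with t ht
      have ht' : (0:ℝ) < t := ht
      have h2 : Real.exp (-s * t) < 1 := Real.exp_lt_one_iff.2 (by nlinarith)
      have h3 := hψ_nonneg t ht'.le
      simp only [Pi.zero_apply]
      nlinarith
  rw [c2] at eqJ
  rw [d2] at eqn
  rw [e2] at eqΦ
  rw [eqΦ, eqn]
  generalize (∫ t in Ioi (0:ℝ), Real.exp (-s * t) * J t) = a at *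
  generalize (∫ t in Ioi (0:ℝ), Real.exp (-s * t) * ψ t) = b at *
  generalize (∫ t in Ioi (0:ℝ), Real.exp (-s * t) * n' t) = c at *
  have h1 : 1 / s - 1 / s * b = (1 - b) / s := by ring
  rw [h1]
  field_simp
  linarith
end

section
/- (Laplace-space form of the Model II master equation with linear reactions.) Let ψ be a waiting-time density with survival probability Φ, let k ∈ ℝ, n₀ ∈ ℝ, and let n, h : [0,∞) → ℝ be measurable such that for some s with s > k and s > 0 the functions t ↦ e^{−st}|n(t)| and t ↦ e^{−st}|h(t)| are integrable, and suppose n(t) = n₀ e^{kt} Φ(t) + ∫_0^t h(t') e^{k(t−t')} ψ(t−t') dt' for almost every t ≥ 0. Then L{n}(s) = n₀ L{Φ}(s−k) + L{h}(s) L{ψ}(s−k), and consequently s L{n}(s) − n₀ = k L{n}(s) + (L{ψ}(s−k)/L{Φ}(s−k)) (L{h}(s) − L{n}(s)). -/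
open Real Set MeasureTheory

/-- Laplace-space form of the Model II master equation with linear
reactions: if `n(t) = n₀ e^{kt} Φ(t) + ∫_0^t h(t') e^{k(t−t')} ψ(t−t') dt'` a.e.,
then `L{n}(s) = n₀ L{Φ}(s−k) + L{h}(s) L{ψ}(s−k)` and
`s L{n}(s) − n₀ = k L{n}(s) + (L{ψ}(s−k)/L{Φ}(s−k)) (L{h}(s) − L{n}(s))`. -/
theorem modelII_master_equation_laplace_reactions
    (ψ Φ : ℝ → ℝ)
    (hψ_nonneg : ∀ t, 0 ≤ t → 0 ≤ ψ t)
    (hψ_int : IntegrableOn ψ (Set.Ioi 0))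
    (hψ_norm : ∫ t in Set.Ioi (0 : ℝ), ψ t = 1)
    (hΦ : ∀ t, Φ t = ∫ t' in Set.Ioi t, ψ t')
    (k n₀ : ℝ) (n h : ℝ → ℝ) (hn_meas : Measurable n) (hh_meas : Measurable h)
    (s : ℝ) (hsk : k < s) (hs : 0 < s)
    (hn_int : IntegrableOn (fun t => Real.exp (-s * t) * |n t|) (Set.Ioi 0))
    (hh_int : IntegrableOn (fun t => Real.exp (-s * t) * |h t|) (Set.Ioi 0))
    (hmaster : ∀ᵐ t ∂(volume.restrict (Set.Ioi (0 : ℝ))),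
      n t = n₀ * Real.exp (k * t) * Φ t
        + ∫ t' in (0 : ℝ)..t, h t' * Real.exp (k * (t - t')) * ψ (t - t')) :
    (∫ t in Set.Ioi (0 : ℝ), Real.exp (-s * t) * n t)
      = n₀ * (∫ t in Set.Ioi (0 : ℝ), Real.exp (-(s - k) * t) * Φ t)
        + (∫ t in Set.Ioi (0 : ℝ), Real.exp (-s * t) * h t) *
          (∫ t in Set.Ioi (0 : ℝ), Real.exp (-(s - k) * t) * ψ t) ∧
    s * (∫ t in Set.Ioi (0 : ℝ), Real.exp (-s * t) * n t) - n₀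
      = k * (∫ t in Set.Ioi (0 : ℝ), Real.exp (-s * t) * n t)
        + ((∫ t in Set.Ioi (0 : ℝ), Real.exp (-(s - k) * t) * ψ t) /
            (∫ t in Set.Ioi (0 : ℝ), Real.exp (-(s - k) * t) * Φ t)) *
          ((∫ t in Set.Ioi (0 : ℝ), Real.exp (-s * t) * h t)
            - ∫ t in Set.Ioi (0 : ℝ), Real.exp (-s * t) * n t) := by
  have hσ : 0 < s - k := by linarith
  set σ := s - k with hσd
  have hE : IntegrableOn (fun t : ℝ => Real.exp (-σ * t)) (Ioi 0) :=
    integrableOn_exp_mul_Ioi (by linarith) 0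
  have hEi : ∫ t in Ioi (0 : ℝ), Real.exp (-σ * t) = 1 / σ := by
    rw [integral_exp_mul_Ioi (by linarith) 0]
    simp
  have hG : IntegrableOn (fun t => Real.exp (-σ * t) * ψ t) (Ioi 0) := by
    refine Integrable.mono hψ_int
      ((Continuous.aestronglyMeasurable (by fun_prop)).mul hψ_int.1) ?_
    filter_upwards [ae_restrict_mem measurableSet_Ioi] with t ht
    rw [norm_mul, Real.norm_eq_abs (Real.exp _), abs_of_pos (Real.exp_pos _)]
    refine mul_le_of_le_one_left (norm_nonneg _) (Real.exp_le_one_iff.2 ?_)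
    have : 0 < σ * t := mul_pos hσ ht
    linarith
  have hF : IntegrableOn (fun t => Real.exp (-s * t) * h t) (Ioi 0) := by
    refine Integrable.mono hh_int (Measurable.aestronglyMeasurable (by fun_prop)) ?_
    filter_upwards with t
    simp
  have hc1 := integral_posConvolution hE hG (ContinuousLinearMap.mul ℝ ℝ)
  have hc2 := integral_posConvolution hF hG (ContinuousLinearMap.mul ℝ ℝ)
  have hi1 := integrable_posConvolution hE hG (ContinuousLinearMap.mul ℝ ℝ)
  have hi2 := integrable_posConvolution hF hG (ContinuousLinearMap.mul ℝ ℝ)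
  unfold posConvolution at hi1 hi2
  replace hi1 := (integrable_indicator_iff measurableSet_Ioi).1 hi1
  replace hi2 := (integrable_indicator_iff measurableSet_Ioi).1 hi2
  simp only [ContinuousLinearMap.mul_apply'] at hc1 hc2 hi1 hi2
  have e1 : EqOn (fun x => ∫ t in (0:ℝ)..x, Real.exp (-σ * t) * (Real.exp (-σ * (x - t)) * ψ (x - t)))
      (fun x => Real.exp (-σ * x) - Real.exp (-σ * x) * Φ x) (Ioi 0) := by
    intro x hx
    have hx0 : (0:ℝ) < x := hx
    have h1 : ∀ t, Real.exp (-σ * t) * (Real.exp (-σ * (x - t)) * ψ (x - t))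
        = Real.exp (-σ * x) * ψ (x - t) := by
      intro t
      rw [← mul_assoc, ← Real.exp_add]
      congr 2
      ring
    simp only [h1, intervalIntegral.integral_const_mul]
    rw [intervalIntegral.integral_comp_sub_left (fun t => ψ t) x]
    simp only [sub_self, sub_zero]
    have h2 := intervalIntegral.integral_Ioi_sub_Ioi hψ_int hx0.le
    rw [hψ_norm, ← hΦ] at h2
    rw [← h2]
    ring
  have hΦi : IntegrableOn (fun t => Real.exp (-σ * t) * Φ t) (Ioi 0) := by
    have := hE.sub (hi1.congr_fun e1 measurableSet_Ioi)
    refine this.congr (Filter.Eventually.of_forall fun t => ?_)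
    simp
  rw [setIntegral_congr_fun measurableSet_Ioi e1, integral_sub hE hΦi, hEi] at hc1
  have hQ : ∫ t in Ioi (0 : ℝ), Real.exp (-σ * t) * ψ t < 1 := by
    rw [← hψ_norm]
    have hle : ∀ t ∈ Ioi (0:ℝ), 0 ≤ ψ t - Real.exp (-σ * t) * ψ t := by
      intro t ht
      have h0 := hψ_nonneg t (le_of_lt ht)
      have h1 : Real.exp (-σ * t) ≤ 1 := by
        refine (Real.exp_le_one_iff.2 ?_)
        have : 0 < σ * t := mul_pos hσ ht
        linarith
      nlinarith
    have h3 : 0 ≤ ∫ t in Ioi (0 : ℝ), (ψ t - Real.exp (-σ * t) * ψ t) :=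
      setIntegral_nonneg measurableSet_Ioi hle
    have h4 : ∫ t in Ioi (0 : ℝ), (ψ t - Real.exp (-σ * t) * ψ t) ≠ 0 := by
      intro hz
      rw [setIntegral_eq_zero_iff_of_nonneg_ae ((ae_restrict_iff' measurableSet_Ioi).2
        (Filter.Eventually.of_forall hle)) (hψ_int.sub hG)] at hz
      have : ∫ t in Ioi (0 : ℝ), ψ t = 0 := by
        apply integral_eq_zero_of_ae
        filter_upwards [hz, ae_restrict_mem measurableSet_Ioi] with t h1 ht
        have h5 : Real.exp (-σ * t) < 1 := by
          refine (Real.exp_lt_one_iff.2 ?_)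
          have : 0 < σ * t := mul_pos hσ ht
          linarith
        simp only [Pi.zero_apply] at h1 ⊢
        have : (1 - Real.exp (-σ * t)) * ψ t = 0 := by linarith
        rcases mul_eq_zero.1 this with h | h
        · linarith
        · exact h
      linarith
    rw [integral_sub hψ_int hG] at h3 h4
    have := lt_of_le_of_ne h3 h4.symm
    linarith
  have hN : (∫ t in Ioi (0 : ℝ), Real.exp (-s * t) * n t)
      = n₀ * (∫ t in Ioi (0 : ℝ), Real.exp (-σ * t) * Φ t)
        + (∫ t in Ioi (0 : ℝ), Real.exp (-s * t) * h t) *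
          (∫ t in Ioi (0 : ℝ), Real.exp (-σ * t) * ψ t) := by
    rw [← hc2, ← integral_const_mul, ← integral_add (hΦi.const_mul n₀) hi2]
    apply integral_congr_ae
    filter_upwards [hmaster] with t ht
    rw [ht, mul_add, ← intervalIntegral.integral_const_mul]
    congr 1
    · have : Real.exp (-σ * t) = Real.exp (-s * t) * Real.exp (k * t) := by
        rw [← Real.exp_add]; congr 1; rw [hσd]; ring
      rw [this]; ring
    · congr 1
      ext x
      have : Real.exp (-s * t) * Real.exp (k * (t - x))
          = Real.exp (-s * x) * Real.exp (-σ * (t - x)) := by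
        rw [← Real.exp_add, ← Real.exp_add]; congr 1; rw [hσd]; ring
      linear_combination (h x * ψ (t - x)) * this
  refine ⟨hN, ?_⟩
  generalize (∫ t in Ioi (0 : ℝ), Real.exp (-s * t) * n t) = N at *
  generalize (∫ t in Ioi (0 : ℝ), Real.exp (-σ * t) * Φ t) = P at *
  generalize (∫ t in Ioi (0 : ℝ), Real.exp (-s * t) * h t) = H at *
  generalize (∫ t in Ioi (0 : ℝ), Real.exp (-σ * t) * ψ t) = Q at *
  have hP : σ * P = 1 - Q := by
    field_simp at hc1
    linarith
  have hP0 : 0 < P := by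
    have : 0 < σ * P := by linarith
    exact (mul_pos_iff_of_pos_left hσ).1 this
  have hs' : s = σ + k := by rw [hσd]; ring
  have key : σ * N - n₀ = Q / P * (H - N) := by
    field_simp
    linear_combination N * hP + hN
  rw [hs']
  linarith
end

section
/- (Model III loss flux with linear reactions in Laplace space.) Let ψ be a waiting-time density with survival probability Φ, let k ∈ ℝ, n₀ ∈ ℝ, and let n, J : [0,∞) → ℝ with n locally absolutely continuous, n(0) = n₀, such that for some s with s > k and s > 0 the functions t ↦ e^{−st}|J(t)|, t ↦ e^{−st}|n(t)| and t ↦ e^{−st}|n'(t)| are integrable and e^{−st} n(t) → 0 as t → ∞. If J(t) = e^{kt} ψ(t) n₀ + ∫_0^t e^{k(t−t')} ψ(t−t') [J(t') + n'(t') − k n(t')] dt' for almost every t ≥ 0, then L{J}(s) = (L{ψ}(s−k)/L{Φ}(s−k)) L{n}(s). -/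
open Real Set Filter MeasureTheory

lemma aux_hull (j : ℝ → ℝ) (hj : AEMeasurable (fun x => |j x|) volume) :
    ∃ B : Set ℝ, MeasurableSet B ∧ AEMeasurable (Bᶜ.indicator j) volume ∧
      ∀ E : Set ℝ, MeasurableSet E → AEMeasurable j (volume.restrict E) →
        volume (E ∩ B) = 0 := by
  classical
  set P : Set ℝ := {x | 0 < j x} with hP
  set H := toMeasurable volume P with hH
  set K := toMeasurable volume Pᶜ with hK
  have hHm : MeasurableSet H := measurableSet_toMeasurable _ _
  have hKm : MeasurableSet K := measurableSet_toMeasurable _ _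
  have hPH : P ⊆ H := subset_toMeasurable _ _
  have hPK : Pᶜ ⊆ K := subset_toMeasurable _ _
  refine ⟨H ∩ K, hHm.inter hKm, ?_, ?_⟩
  · have : (H ∩ K)ᶜ.indicator j = (H ∩ K)ᶜ.indicator
        (fun x => H.indicator (fun x => |j x|) x - Hᶜ.indicator (fun x => |j x|) x) := by
      ext x
      by_cases hx : x ∈ (H ∩ K)ᶜ
      · rw [indicator_of_mem hx, indicator_of_mem hx]
        by_cases hxH : x ∈ H
        · have hxK : x ∉ K := fun h => hx ⟨hxH, h⟩
          have : x ∈ P := by by_contra h; exact hxK (hPK h)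
          have h0 : 0 < j x := this
          simp [hxH, abs_of_pos h0]
        · have : x ∉ P := fun h => hxH (hPH h)
          have h0 : j x ≤ 0 := not_lt.mp this
          simp [hxH, abs_of_nonpos h0]
      · rw [indicator_of_notMem hx, indicator_of_notMem hx]
    rw [this]
    exact ((hj.indicator hHm).sub (hj.indicator hHm.compl)).indicator (hHm.inter hKm).compl
  · intro E hE hjE
    obtain ⟨g, hg, hgj⟩ := hjE
    set Q : Set ℝ := {x | 0 < g x} with hQ
    have hQm : MeasurableSet Q := measurableSet_lt measurable_const hg
    rw [EventuallyEq, ae_restrict_iff' hE, ae_iff] at hgj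
    have h1 : volume (H ∩ (E ∩ Qᶜ)) = 0 := by
      rw [hH, Measure.measure_toMeasurable_inter_of_sFinite (hE.inter hQm.compl)]
      refine measure_mono_null ?_ hgj
      rintro x ⟨hx1, hx2, hx3⟩
      intro h
      have h4 := h hx2
      apply hx3
      change 0 < g x
      rw [← h4]; exact hx1
    have h2 : volume (K ∩ (E ∩ Q)) = 0 := by
      rw [hK, Measure.measure_toMeasurable_inter_of_sFinite (hE.inter hQm)]
      refine measure_mono_null ?_ hgj
      rintro x ⟨hx1, hx2, hx3⟩
      intro h
      have h4 := h hx2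
      apply hx1
      change 0 < j x
      rw [h4]; exact hx3
    refine measure_mono_null ?_ (measure_union_null h1 h2)
    rintro x ⟨hx1, hx2, hx3⟩
    by_cases h : x ∈ Q
    · exact Or.inr ⟨hx3, hx1, h⟩
    · exact Or.inl ⟨hx2, hx1, h⟩

lemma aux_meas (p j m : ℝ → ℝ) (c : ℝ) (hp : Integrable p) (hm : Integrable m)
    (hj : Integrable (fun x => |j x|))
    (heq : ∀ᵐ t, j t = c * p t + ∫ u, (j u + m u) * p (t - u)) : Integrable j := by
  obtain ⟨B, hB, hjB, hmax⟩ := aux_hull j hj.aemeasurable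
  have hjB' : Integrable (Bᶜ.indicator j) := by
    refine hj.mono hjB.aestronglyMeasurable (Eventually.of_forall fun x => ?_)
    by_cases hx : x ∈ Bᶜ
    · rw [indicator_of_mem hx]; simp
    · rw [indicator_of_notMem hx]; simp
  obtain ⟨q, hq, hpq⟩ := hp.aemeasurable
  have hqi : Integrable q := hp.congr hpq
  have hpq' : ∀ t : ℝ, ∀ᵐ u, p (t - u) = q (t - u) := fun t =>
    (quasiMeasurePreserving_sub_left volume t).ae hpq
  set S : Set ℝ := {x | q x ≠ 0} with hS
  have hSm : MeasurableSet S := (hq (measurableSet_singleton (0:ℝ))).compl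
  let E : ℝ → Set ℝ := fun t => {u | t - u ∈ S}
  have hE : ∀ t, MeasurableSet (E t) := fun t => hSm.preimage (measurable_const.sub measurable_id)
  have hφ : Measurable fun t : ℝ => volume (E t ∩ B) := by
    have hT : MeasurableSet {z : ℝ × ℝ | z.1 - z.2 ∈ S ∧ z.2 ∈ B} :=
      (hSm.preimage (measurable_fst.sub measurable_snd)).inter (hB.preimage measurable_snd)
    exact measurable_measure_prodMk_left hT
  have hM : MeasurableSet {t : ℝ | volume (E t ∩ B) = 0} := hφ (measurableSet_singleton 0)
  have hconv : Integrable (fun t => ∫ u, (Bᶜ.indicator j u + m u) * q (t - u)) :=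
    Integrable.integrable_convolution (ContinuousLinearMap.mul ℝ ℝ) (hjB'.add hm) hqi
  have key : ∀ t, ∫ u, (j u + m u) * p (t - u) =
      {t : ℝ | volume (E t ∩ B) = 0}.indicator
        (fun t => ∫ u, (Bᶜ.indicator j u + m u) * q (t - u)) t := by
    intro t
    have e1 : ∫ u, (j u + m u) * p (t - u) = ∫ u, (j u + m u) * q (t - u) :=
      integral_congr_ae ((hpq' t).mono fun u hu => by simp only [hu])
    rw [e1]
    by_cases ht : volume (E t ∩ B) = 0
    · rw [indicator_of_mem (by exact ht)]
      refine integral_congr_ae ?_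
      have : ∀ᵐ u, u ∉ E t ∩ B := measure_eq_zero_iff_ae_notMem.mp ht
      filter_upwards [this] with u hu
      by_cases hub : u ∈ B
      · have : q (t - u) = 0 := by
          by_contra h
          exact hu ⟨h, hub⟩
        simp [this]
      · rw [indicator_of_mem (by exact hub)]
    · rw [indicator_of_notMem (by exact ht)]
      refine integral_undef fun hint => ht (hmax _ (hE t) ?_)
      have h1 : AEMeasurable (fun u => (j u + m u) * q (t - u) / q (t - u) - m u)
          (volume.restrict (E t)) :=
        ((hint.aemeasurable.div
          (hq.comp (measurable_const.sub measurable_id)).aemeasurable).sub hm.aemeasurable).restrict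
      refine h1.congr ?_
      filter_upwards [ae_restrict_mem (hE t)] with u hu
      have : q (t - u) ≠ 0 := hu
      field_simp
      ring
  have hI : Integrable (fun t => c * p t + ∫ u, (j u + m u) * p (t - u)) := by
    refine (hp.const_mul c).add ?_
    simp_rw [key]
    exact hconv.indicator hM
  exact hI.congr (heq.mono fun t ht => ht.symm)

/-- Laplace transform of a primitive. -/
lemma aux_prim (f : ℝ → ℝ) (σ : ℝ) (hσ : 0 < σ)
    (hf : IntegrableOn (fun t => Real.exp (-σ * t) * f t) (Ioi 0)) :
    IntegrableOn (fun t => Real.exp (-σ * t) * ∫ u in (0:ℝ)..t, f u) (Ioi 0) ∧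
    ∫ t in Ioi (0:ℝ), Real.exp (-σ * t) * ∫ u in (0:ℝ)..t, f u =
      (∫ t in Ioi (0:ℝ), Real.exp (-σ * t) * f t) * (1 / σ) := by
  have he : IntegrableOn (fun t => Real.exp (-σ * t)) (Ioi 0) := exp_neg_integrableOn_Ioi 0 hσ
  have hei : ∫ t in Ioi (0:ℝ), Real.exp (-σ * t) = 1 / σ := by
    rw [integral_exp_mul_Ioi (by linarith)]
    simp [neg_div_neg_eq]
  have h1 := integrable_posConvolution hf he (ContinuousLinearMap.mul ℝ ℝ)
  have h2 := integral_posConvolution hf he (ContinuousLinearMap.mul ℝ ℝ)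
  have e : ∀ x : ℝ, ∫ t in (0:ℝ)..x, (ContinuousLinearMap.mul ℝ ℝ) (Real.exp (-σ * t) * f t)
      (Real.exp (-σ * (x - t))) = Real.exp (-σ * x) * ∫ u in (0:ℝ)..x, f u := by
    intro x
    rw [← intervalIntegral.integral_const_mul]
    congr 1 with t
    have : Real.exp (-σ * x) = Real.exp (-σ * t) * Real.exp (-σ * (x - t)) := by
      rw [← Real.exp_add]; ring_nf
    rw [this, ContinuousLinearMap.mul_apply']; ring
  simp_rw [e] at h2
  rw [hei] at h2
  refine ⟨?_, h2⟩
  unfold posConvolution at h1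
  simp_rw [e] at h1
  exact (integrable_indicator_iff measurableSet_Ioi).mp h1

/-- Model III loss flux with linear reactions in Laplace space:
if `J(t) = e^{kt} ψ(t) n₀ + ∫_0^t e^{k(t−t')} ψ(t−t')[J(t') + n'(t') − k n(t')] dt'` a.e.,
then `L{J}(s) = (L{ψ}(s−k)/L{Φ}(s−k)) L{n}(s)`. -/
theorem modelIII_loss_flux_laplace_reactions
    (ψ Φ : ℝ → ℝ)
    (hψ_nonneg : ∀ t, 0 ≤ t → 0 ≤ ψ t)
    (hψ_int : IntegrableOn ψ (Set.Ioi 0))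
    (hψ_norm : ∫ t in Set.Ioi (0 : ℝ), ψ t = 1)
    (hΦ : ∀ t, Φ t = ∫ t' in Set.Ioi t, ψ t')
    (k n₀ : ℝ) (n n' J : ℝ → ℝ)
    (hn'_loc : LocallyIntegrableOn n' (Set.Ici 0))
    (hn_ac : ∀ t : ℝ, 0 ≤ t → n t = n₀ + ∫ u in (0 : ℝ)..t, n' u)
    (hn0 : n 0 = n₀)
    (s : ℝ) (hsk : k < s) (hs : 0 < s)
    (hJ_int : IntegrableOn (fun t => Real.exp (-s * t) * |J t|) (Set.Ioi 0))
    (hn_int : IntegrableOn (fun t => Real.exp (-s * t) * |n t|) (Set.Ioi 0))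
    (hn'_int : IntegrableOn (fun t => Real.exp (-s * t) * |n' t|) (Set.Ioi 0))
    (hdecay : Tendsto (fun t => Real.exp (-s * t) * n t) atTop (nhds 0))
    (hflux : ∀ᵐ t ∂(volume.restrict (Set.Ioi (0 : ℝ))),
      J t = Real.exp (k * t) * ψ t * n₀
        + ∫ t' in (0 : ℝ)..t,
            Real.exp (k * (t - t')) * ψ (t - t') * (J t' + n' t' - k * n t')) :
    (∫ t in Set.Ioi (0 : ℝ), Real.exp (-s * t) * J t)
      = ((∫ t in Set.Ioi (0 : ℝ), Real.exp (-(s - k) * t) * ψ t) /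
          (∫ t in Set.Ioi (0 : ℝ), Real.exp (-(s - k) * t) * Φ t)) *
        (∫ t in Set.Ioi (0 : ℝ), Real.exp (-s * t) * n t) := by
  have hσ : 0 < s - k := sub_pos.mpr hsk
  -- the density
  have hp : IntegrableOn (fun t => Real.exp (-(s - k) * t) * ψ t) (Ioi 0) := by
    refine Integrable.mono hψ_int ?_ ?_
    · exact (Continuous.aestronglyMeasurable (by fun_prop)).mul hψ_int.aestronglyMeasurable
    · filter_upwards [ae_restrict_mem measurableSet_Ioi] with t ht
      have ht : 0 < t := ht
      rw [norm_mul, Real.norm_eq_abs (Real.exp _), abs_of_pos (Real.exp_pos _)]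
      refine mul_le_of_le_one_left (norm_nonneg _) (Real.exp_le_one_iff.mpr ?_)
      nlinarith
  -- n'
  have hn'm : IntegrableOn (fun t => Real.exp (-s * t) * n' t) (Ioi 0) := by
    refine Integrable.mono hn'_int ?_ ?_
    · refine (Continuous.aestronglyMeasurable (by fun_prop)).mul ?_
      exact hn'_loc.aestronglyMeasurable.mono_measure
        (Measure.restrict_mono Ioi_subset_Ici_self le_rfl)
    · exact Eventually.of_forall fun t => by simp
  have he : ∀ {a : ℝ}, 0 < a → IntegrableOn (fun t => Real.exp (-a * t)) (Ioi 0) :=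
    fun ha => exp_neg_integrableOn_Ioi 0 ha
  have hei : ∀ {a : ℝ}, 0 < a → ∫ t in Ioi (0:ℝ), Real.exp (-a * t) = 1 / a := by
    intro a ha
    rw [integral_exp_mul_Ioi (by linarith)]
    simp [neg_div_neg_eq]
  obtain ⟨hprim, hprimv⟩ := aux_prim n' s hs hn'm
  have hncongr : EqOn (fun t => Real.exp (-s * t) * n₀ + Real.exp (-s * t) * ∫ u in (0:ℝ)..t, n' u)
      (fun t => Real.exp (-s * t) * n t) (Ioi 0) := by
    intro t ht
    simp only [hn_ac t (le_of_lt ht)]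
    ring
  have hnI : IntegrableOn (fun t => Real.exp (-s * t) * n t) (Ioi 0) :=
    IntegrableOn.congr_fun (((he hs).mul_const n₀).add hprim) hncongr measurableSet_Ioi
  have hnv : ∫ t in Ioi (0:ℝ), Real.exp (-s * t) * n t =
      1 / s * n₀ + (∫ t in Ioi (0:ℝ), Real.exp (-s * t) * n' t) * (1 / s) := by
    rw [← setIntegral_congr_fun measurableSet_Ioi hncongr,
      integral_add ((he hs).mul_const n₀) hprim, integral_mul_const, hei hs, hprimv]
  -- Φ
  obtain ⟨hprimψ, hprimψv⟩ := aux_prim ψ (s - k) hσ hp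
  have hΦcongr : EqOn (fun t => Real.exp (-(s - k) * t) * Φ t)
      (fun t => Real.exp (-(s - k) * t) - Real.exp (-(s - k) * t) * ∫ u in (0:ℝ)..t, ψ u)
      (Ioi 0) := by
    intro t ht
    have h1 : (∫ u in (0:ℝ)..t, ψ u) + ∫ u in Ioi t, ψ u = 1 := by
      rw [intervalIntegral.integral_interval_add_Ioi hψ_int
        (hψ_int.mono_set (Ioi_subset_Ioi (le_of_lt ht))), hψ_norm]
    simp only [hΦ t]
    rw [eq_sub_of_add_eq' h1]
    ring
  have hΦv : ∫ t in Ioi (0:ℝ), Real.exp (-(s - k) * t) * Φ t =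
      1 / (s - k) - (∫ t in Ioi (0:ℝ), Real.exp (-(s - k) * t) * ψ t) * (1 / (s - k)) := by
    rw [setIntegral_congr_fun measurableSet_Ioi hΦcongr, integral_sub (he hσ) hprimψ, hei hσ,
      hprimψv]
  -- strict inequality
  have hne : (∫ t in Ioi (0:ℝ), Real.exp (-(s - k) * t) * ψ t) ≠ 1 := by
    intro h
    have h0 : ∫ t in Ioi (0:ℝ), (ψ t - Real.exp (-(s - k) * t) * ψ t) = 0 := by
      rw [integral_sub hψ_int hp, h, hψ_norm, sub_self]
    have hnn : 0 ≤ᵐ[volume.restrict (Ioi (0:ℝ))]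
        fun t => ψ t - Real.exp (-(s - k) * t) * ψ t := by
      filter_upwards [ae_restrict_mem measurableSet_Ioi] with t ht
      have ht : 0 < t := ht
      have h1 : Real.exp (-(s - k) * t) ≤ 1 := Real.exp_le_one_iff.mpr (by nlinarith)
      have h2 := hψ_nonneg t ht.le
      simp only [Pi.zero_apply]
      nlinarith
    have h3 := (integral_eq_zero_iff_of_nonneg_ae hnn (hψ_int.sub hp)).mp h0
    have h4 : ψ =ᵐ[volume.restrict (Ioi (0:ℝ))] 0 := by
      filter_upwards [h3, ae_restrict_mem measurableSet_Ioi] with t h3 ht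
      have ht : 0 < t := ht
      have h1 : Real.exp (-(s - k) * t) < 1 := Real.exp_lt_one_iff.mpr (by nlinarith)
      simp only [Pi.zero_apply] at h3 ⊢
      have : (1 - Real.exp (-(s - k) * t)) * ψ t = 0 := by linarith
      rcases mul_eq_zero.mp this with h | h
      · linarith
      · exact h
    rw [integral_congr_ae h4] at hψ_norm
    simp at hψ_norm
  -- the flux equation
  set p : ℝ → ℝ := fun t => Real.exp (-(s - k) * t) * ψ t with hpdef
  set j : ℝ → ℝ := fun t => Real.exp (-s * t) * J t with hjdef
  set m : ℝ → ℝ := fun t => Real.exp (-s * t) * n' t - k * (Real.exp (-s * t) * n t) with hmdef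
  have hm : IntegrableOn m (Ioi 0) := hn'm.sub (hnI.const_mul k)
  have hfl : ∀ t : ℝ, Real.exp (-s * t) * (Real.exp (k * t) * ψ t * n₀
        + ∫ t' in (0 : ℝ)..t,
            Real.exp (k * (t - t')) * ψ (t - t') * (J t' + n' t' - k * n t'))
      = n₀ * p t + ∫ u in (0:ℝ)..t, (ContinuousLinearMap.mul ℝ ℝ) (j u + m u) (p (t - u)) := by
    intro t
    rw [mul_add, ← intervalIntegral.integral_const_mul]
    congr 1
    · have : Real.exp (-(s - k) * t) = Real.exp (-s * t) * Real.exp (k * t) := by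
        rw [← Real.exp_add]; ring_nf
      simp only [hpdef, this]; ring
    · congr 1 with u
      have : Real.exp (-s * u) * Real.exp (-(s - k) * (t - u))
          = Real.exp (-s * t) * Real.exp (k * (t - u)) := by
        rw [← Real.exp_add, ← Real.exp_add]; ring_nf
      simp only [hpdef, hjdef, hmdef, ContinuousLinearMap.mul_apply']
      linear_combination (-(ψ (t - u) * (J u + n' u - k * n u))) * this
  have hjI : IntegrableOn j (Ioi 0) := by
    rw [← integrable_indicator_iff measurableSet_Ioi]
    refine aux_meas ((Ioi 0).indicator p) ((Ioi 0).indicator j) ((Ioi 0).indicator m) n₀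
      ((integrable_indicator_iff measurableSet_Ioi).mpr hp)
      ((integrable_indicator_iff measurableSet_Ioi).mpr hm) ?_ ?_
    · have := (integrable_indicator_iff (measurableSet_Ioi (a := (0:ℝ)))).mpr hJ_int
      refine this.congr (Eventually.of_forall fun t => ?_)
      by_cases ht : t ∈ Ioi (0:ℝ)
      · simp only [indicator_of_mem ht, hjdef, abs_mul, abs_of_pos (Real.exp_pos _)]
      · simp only [indicator_of_notMem ht, abs_zero]
    · have hc := posConvolution_eq_convolution_indicator (fun u => j u + m u) p
        (ContinuousLinearMap.mul ℝ ℝ) volume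
      rw [ae_restrict_iff' measurableSet_Ioi] at hflux
      filter_upwards [hflux] with t hft
      have hct := congrFun hc t
      have hr : ∫ u, ((Ioi 0).indicator j u + (Ioi 0).indicator m u) * (Ioi 0).indicator p (t - u)
          = posConvolution (fun u => j u + m u) p (ContinuousLinearMap.mul ℝ ℝ) volume t := by
        rw [hct, convolution_def]
        congr 1 with u
        rw [ContinuousLinearMap.mul_apply']
        congr 1
        by_cases hu : u ∈ Ioi (0:ℝ)
        · simp only [indicator_of_mem hu]
        · simp only [indicator_of_notMem hu, add_zero]
      rw [hr, posConvolution]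
      by_cases ht : t ∈ Ioi (0:ℝ)
      · simp only [indicator_of_mem ht]
        rw [← hfl t, ← hft ht]
      · simp only [indicator_of_notMem ht, mul_zero, add_zero]
  have hjm : IntegrableOn (fun u => j u + m u) (Ioi 0) := hjI.add hm
  have hc1 := integrable_posConvolution hjm hp (ContinuousLinearMap.mul ℝ ℝ)
  have hc2 := integral_posConvolution hjm hp (ContinuousLinearMap.mul ℝ ℝ)
  have hc1' := (integrable_indicator_iff measurableSet_Ioi).mp hc1
  have hjv : ∫ t in Ioi (0:ℝ), j t = n₀ * (∫ t in Ioi (0:ℝ), p t)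
      + ((∫ t in Ioi (0:ℝ), j t) + ∫ t in Ioi (0:ℝ), m t) * ∫ t in Ioi (0:ℝ), p t := by
    rw [← integral_add hjI hm, ← integral_const_mul]
    rw [ContinuousLinearMap.mul_apply'] at hc2
    rw [← hc2, ← integral_add (hp.const_mul n₀) hc1']
    refine integral_congr_ae (hflux.mono fun t ht => ?_)
    have h5 := hfl t
    rw [← ht] at h5
    exact h5
  have hmv : ∫ t in Ioi (0:ℝ), m t = (∫ t in Ioi (0:ℝ), Real.exp (-s * t) * n' t)
      - k * ∫ t in Ioi (0:ℝ), Real.exp (-s * t) * n t := by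
    rw [← integral_const_mul, ← integral_sub hn'm (hnI.const_mul k)]
  have hsn : (∫ t in Ioi (0:ℝ), Real.exp (-s * t) * n' t) =
      s * (∫ t in Ioi (0:ℝ), Real.exp (-s * t) * n t) - n₀ := by
    rw [hnv]; field_simp; ring
  rw [hΦv]
  rw [hmv, hsn] at hjv
  generalize (∫ t in Ioi (0:ℝ), j t) = X at *
  generalize (∫ t in Ioi (0:ℝ), p t) = P at *
  generalize (∫ t in Ioi (0:ℝ), Real.exp (-s * t) * n t) = N at *
  have hP1 : 1 - P ≠ 0 := sub_ne_zero.mpr (Ne.symm hne)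
  have hsk' : s - k ≠ 0 := hσ.ne'
  have e1 : 1 / (s - k) - P * (1 / (s - k)) = (1 - P) / (s - k) := by ring
  rw [e1]
  field_simp
  linear_combination hjv
end
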